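/- Let C be a diamond category and W a narrow formation of finite complexity, and let E ∈ W. If (M_G)_G is well-behaved at W and v_{W,H} ≥ 0 for all H ∈ W, then ∑_{H ∈ W} |Epi(H,E)| · v_{W,H} = M_E. -/

import Mathlib

open CategoryTheory Opposite Filter Topology MeasureTheory
open scoped ENNReal Classical

universe u

namespace MomentCat

variable {C : Type u} [SmallCategory C]

/-- The poset of isomorphism classes of quotient objects of `G`,
realized as subobjects of `op G` in `Cᵒᵖ`.  The order is: `a ≤ b` iff `a` is a
further quotient of `b`, so that `⊤` is the class of the identity `G → G`. -/
abbrev Quotients (G : C) := Subobject (op G)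

/-- The join of two quotient classes (the least upper bound, when it exists). -/
noncomputable def qSup {G : C} (a b : Quotients G) : Quotients G :=
  if h : ∃ c, IsLUB {a, b} c then h.choose else a

/-- The meet of two quotient classes (the greatest lower bound, when it exists). -/
noncomputable def qInf {G : C} (a b : Quotients G) : Quotients G :=
  if h : ∃ c, IsGLB {a, b} c then h.choose else a

/-- The join of a set of quotient classes (when it exists). -/
noncomputable def qsSup {G : C} (s : Set (Quotients G)) : Quotients G :=
  if h : ∃ c, IsLUB s c then h.choose else ⊤

/-- The quotient class determined by an epimorphism `π : G ⟶ F`. -/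
noncomputable def quotOf {G F : C} (π : G ⟶ F) (h : Epi π) : Quotients G :=
  haveI := h
  Subobject.mk π.op

/-- The underlying object of a quotient class. -/
noncomputable def qObj {G : C} (a : Quotients G) : C :=
  unop (Subobject.underlying.obj a)

/-- An object is minimal if its only quotient is itself. -/
def IsMinimalObj (G : C) : Prop := Subsingleton (Quotients G)

/-- An epimorphism is simple if it is not an isomorphism and the interval
`[F, G]` contains only the two endpoints. -/
def IsSimpleEpi {G F : C} (π : G ⟶ F) : Prop :=
  ∃ h : Epi π, ¬IsIso π ∧ ∀ X : Quotients G, quotOf π h ≤ X → X = quotOf π h ∨ X = ⊤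

/-- The interval `[a, ⊤]` is a complemented lattice. -/
def IntervalComplTop {G : C} (a : Quotients G) : Prop :=
  ∀ X : Quotients G, a ≤ X → ∃ Y : Quotients G, a ≤ Y ∧ qSup X Y = ⊤ ∧ qInf X Y = a

/-- The interval `[a, b]` is a complemented lattice. -/
def IntervalCompl {G : C} (a b : Quotients G) : Prop :=
  ∀ X : Quotients G, a ≤ X → X ≤ b →
    ∃ Y : Quotients G, a ≤ Y ∧ Y ≤ b ∧ qSup X Y = b ∧ qInf X Y = a

/-- An epimorphism `π : G ⟶ F` is semisimple if the interval `[F,G]` is complemented. -/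
def IsSemisimpleEpi {G F : C} (π : G ⟶ F) : Prop :=
  ∃ h : Epi π, IntervalComplTop (quotOf π h)

/-- A set of objects (stable under isomorphism) closed under quotients. -/
def DownwardClosed (S : Set C) : Prop :=
  ∀ G ∈ S, ∀ (F : C) (π : G ⟶ F), Epi π → F ∈ S

/-- A set of objects closed under joins of quotients of a common object. -/
def JoinClosed (S : Set C) : Prop :=
  ∀ (G : C) (a b : Quotients G), qObj a ∈ S → qObj b ∈ S →
    (∃ c, IsLUB {a, b} c) → qObj (qSup a b) ∈ S

/-- A set of objects containing all minimal objects. -/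
def MinClosed (S : Set C) : Prop := ∀ G : C, IsMinimalObj G → G ∈ S

/-- A formation: downward-closed, join-closed, containing all minimal objects. -/
def IsFormation (S : Set C) : Prop := DownwardClosed S ∧ JoinClosed S ∧ MinClosed S

/-- The smallest downward-closed join-closed set containing `B` and all minimal objects. -/
def levelGen (B : Set C) : Set C := ⋂₀ {S : Set C | IsFormation S ∧ B ⊆ S}

/-- A level is a formation generated by a finite set of objects. -/
def IsLevel (S : Set C) : Prop := ∃ B : Set C, B.Finite ∧ S = levelGen B

/-- The type of isomorphism classes of objects of `C`. -/
abbrev IsoCls (C : Type u) [SmallCategory C] := Quotient (CategoryTheory.isIsomorphicSetoid C)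

/-- The isomorphism class of an object. -/
def cls (G : C) : IsoCls C := Quotient.mk (CategoryTheory.isIsomorphicSetoid C) G

/-- The set of epimorphisms from `G` to `F`. -/
abbrev Epis (G F : C) := {π : G ⟶ F // Epi π}

/-- There is a chain of covers of length `d` from `a` to `b` (i.e. the morphism
`qObj b → qObj a` has dimension `d`). -/
def CovChain {G : C} (a b : Quotients G) (d : ℕ) : Prop :=
  ∃ c : Fin (d + 1) → Quotients G, c 0 = a ∧ c (Fin.last d) = b ∧
    ∀ i : Fin d, c i.castSucc ⋖ c i.succ

/-- An epimorphism has dimension `d`. -/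
def EpiDim {G F : C} (π : G ⟶ F) (h : Epi π) (d : ℕ) : Prop :=
  CovChain (quotOf π h) ⊤ d

/-- A set of isomorphism classes is narrow if each of its members receives simple
epimorphisms from only finitely many of its members (up to isomorphism). -/
def Narrow (S : Set C) : Prop :=
  ∀ G ∈ S, {X : IsoCls C | X.out ∈ S ∧ ∃ π : X.out ⟶ G, IsSimpleEpi π}.Finite

/-- The minimal quotient: the bottom of the quotient poset, when it exists. -/
noncomputable def qBot (G : C) : Quotients G :=
  if h : ∃ b : Quotients G, ∀ x, b ≤ x then h.choose else ⊤

/-- `G` has complexity at most `k`: the map to the minimal quotient is a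
composition of `k` semisimple epimorphisms. -/
def complexityLE (G : C) (k : ℕ) : Prop :=
  ∃ c : Fin (k + 1) → Quotients G, c 0 = qBot G ∧ c (Fin.last k) = ⊤ ∧
    ∀ i : Fin k, c i.castSucc ≤ c i.succ ∧ IntervalCompl (c i.castSucc) (c i.succ)

/-- A diamond category. -/
structure IsDiamond (C : Type u) [SmallCategory C] : Prop where
  /-- quotient posets are finite … -/
  quotFinite : ∀ G : C, Finite (Quotients G)
  /-- … and are lattices: all pairwise joins exist … -/
  lub : ∀ (G : C) (a b : Quotients G), ∃ c, IsLUB {a, b} c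
  /-- … and all pairwise meets exist … -/
  glb : ∀ (G : C) (a b : Quotients G), ∃ c, IsGLB {a, b} c
  /-- … and are modular. -/
  modular : ∀ (G : C) (a b x : Quotients G), a ≤ b →
    qSup a (qInf x b) = qInf (qSup a x) b
  /-- automorphism groups are finite -/
  autFinite : ∀ G : C, Finite (Aut G)
  /-- levels are narrow -/
  levelNarrow : ∀ S : Set C, IsLevel S → Narrow S
  /-- countably many isomorphism classes of minimal objects -/
  minCountable : Set.Countable {X : IsoCls C | IsMinimalObj X.out}

/-- A family assigning to each object the Möbius function of its quotient poset:
`mob G x x = 1` and for `x < y`, `∑_{x ≤ z ≤ y} mob G x z = 0`. -/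
def IsMobiusFamily (mob : ∀ G : C, Quotients G → Quotients G → ℝ) : Prop :=
  ∀ G : C, (∀ x : Quotients G, mob G x x = 1) ∧
    ∀ x y : Quotients G, x < y → ∑ᶠ z ∈ Set.Icc x y, mob G x z = 0

/-- `μ(π) = μ(F, G)` for an epimorphism `π : G ⟶ F`. -/
noncomputable def muEpi (mob : ∀ G : C, Quotients G → Quotients G → ℝ)
    {G F : C} (π : G ⟶ F) (h : Epi π) : ℝ :=
  mob G (quotOf π h) ⊤

/-- `μ̂(F,G) = ∑_{π ∈ Epi(G,F)/Aut(F)} μ(π) = (∑_{π ∈ Epi(G,F)} μ(π))/|Aut F|`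
(the `Aut F`-action on epimorphisms being free). -/
noncomputable def muHat (mob : ∀ G : C, Quotients G → Quotients G → ℝ) (F G : C) : ℝ :=
  (∑' π : Epis G F, muEpi mob π.1 π.2) / (Nat.card (Aut F) : ℝ)

/-- `S_{G,F} = |Epi(G,F)|/|Aut F|`. -/
noncomputable def SQ (G F : C) : ℝ :=
  (Nat.card (Epis G F) : ℝ) / (Nat.card (Aut F) : ℝ)

/-- `T_{G,F} = μ̂(F,G)`. -/
noncomputable def TQ (mob : ∀ G : C, Quotients G → Quotients G → ℝ) (G F : C) : ℝ :=
  muHat mob F G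

/-- `Z(π)`: the number of `H ∈ [F,G]` satisfying the distributive law. -/
noncomputable def Zfn {G F : C} (π : G ⟶ F) (h : Epi π) : ℕ :=
  Nat.card {H : Quotients G // quotOf π h ≤ H ∧ ∀ K₁ K₂ : Quotients G,
    quotOf π h ≤ K₁ → quotOf π h ≤ K₂ →
      qSup H (qInf K₁ K₂) = qInf (qSup H K₁) (qSup H K₂)}

/-- The isomorphism classes lying in `W`. -/
abbrev WSub (W : Set C) := {X : IsoCls C // X.out ∈ W}

/-- `(M_G)` is well-behaved at `W`:
`∑_{G ∈ W} ∑_{π ∈ Epi(G,F)} (|μ(F,G)|/|Aut G|) Z(π)³ |M_G| < ∞` for every `F ∈ W`. -/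
def WellBehavedAt (mob : ∀ G : C, Quotients G → Quotients G → ℝ) (M : IsoCls C → ℝ)
    (W : Set C) : Prop :=
  ∀ F : C, F ∈ W → Summable (fun q : Σ X : WSub W, Epis X.1.out F =>
    |mob q.1.1.out (quotOf q.2.1 q.2.2) ⊤| / (Nat.card (Aut q.1.1.out) : ℝ)
      * ((Zfn q.2.1 q.2.2 : ℝ)) ^ 3 * |M q.1.1|)

/-- The `W`-quotient `G^W`: the join of all quotients of `G` lying in `W`. -/
noncomputable def wQuot (W : Set C) (G : C) : Quotients G :=
  qsSup {a : Quotients G | qObj a ∈ W}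

/-- An epimorphism `φ : G ⟶ E` is relative-`W` if `G → G^W ∨ E` is an isomorphism. -/
def RelativeW (W : Set C) {G E : C} (φ : G ⟶ E) (h : Epi φ) : Prop :=
  qSup (wQuot W G) (quotOf φ h) = ⊤

/-- `v_{W,F} = ∑_{G ∈ W} μ̂(F,G) M_G / |Aut G|`. -/
noncomputable def vWF (mob : ∀ G : C, Quotients G → Quotients G → ℝ) (M : IsoCls C → ℝ)
    (W : Set C) (F : C) : ℝ :=
  ∑' X : WSub W, muHat mob F X.1.out * M X.1 / (Nat.card (Aut X.1.out) : ℝ)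

theorem epiComp {G F E : C} {π : G ⟶ F} {ρ : F ⟶ E} (h1 : Epi π) (h2 : Epi ρ) :
    Epi (π ≫ ρ) := by
  haveI := h1; haveI := h2; infer_instance

/-- The radical of an epimorphism with class `a`: the join of all minimal
elements of `[a, ⊤]` distinct from `a` (together with `a` itself). -/
noncomputable def radicalEl {G : C} (a : Quotients G) : Quotients G :=
  qsSup (insert a {X : Quotients G | a ⋖ X})

end MomentCat

namespace MomentAux

/-- Möbius function of a finite poset. -/
noncomputable def mu {P : Type*} [PartialOrder P] [Fintype P] (x y : P) : ℝ :=
  letI : LocallyFiniteOrder P := Fintype.toLocallyFiniteOrder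
  IncidenceAlgebra.mu ℝ x y

section Mu
variable {P : Type*} [PartialOrder P] [Fintype P]

theorem mu_self (x : P) : mu x x = 1 := by
  simp [mu]

theorem mu_sum_right (x y : P) (h : x < y) :
    ∑ z with x ≤ z ∧ z ≤ y, mu x z = 0 := by
  let _ : LocallyFiniteOrder P := Fintype.toLocallyFiniteOrder
  have := IncidenceAlgebra.sum_Icc_mu_right (𝕜 := ℝ) x y
  rw [if_neg h.ne] at this
  rw [← this]
  apply Finset.sum_congr
  · ext z; simp
  · intros; rfl

theorem mu_sum_left (x y : P) (h : x < y) :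
    ∑ z with x ≤ z ∧ z ≤ y, mu z y = 0 := by
  let _ : LocallyFiniteOrder P := Fintype.toLocallyFiniteOrder
  have := IncidenceAlgebra.sum_Icc_mu_left (𝕜 := ℝ) x y
  rw [if_neg h.ne] at this
  rw [← this]
  apply Finset.sum_congr
  · ext z; simp
  · intros; rfl

theorem mu_unique (m : P → ℝ) (x : P) (h1 : m x = 1)
    (h2 : ∀ y, x < y → ∑ z with x ≤ z ∧ z ≤ y, m z = 0) :
    ∀ y, x ≤ y → m y = mu x y := by
  intro y
  induction y using WellFoundedLT.induction with
  | _ y ih =>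
    intro hxy
    rcases hxy.eq_or_lt with rfl | hlt
    · rw [h1, mu_self]
    · have e1 := h2 y hlt
      have e2 := mu_sum_right x y hlt
      have hmem : y ∈ Finset.univ.filter (fun z => x ≤ z ∧ z ≤ y) := by simp [hxy]
      rw [← Finset.add_sum_erase _ _ hmem] at e1 e2
      have : ∑ z ∈ (Finset.univ.filter (fun z => x ≤ z ∧ z ≤ y)).erase y, m z
          = ∑ z ∈ (Finset.univ.filter (fun z => x ≤ z ∧ z ≤ y)).erase y, mu x z := by
        apply Finset.sum_congr rfl
        intro z hz
        simp at hz
        exact ih z (lt_of_le_of_ne hz.2.2 hz.1) hz.2.1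
      linarith

/-- Möbius functions are preserved by embeddings with order-connected image. -/
theorem mu_embed {Q : Type*} [PartialOrder Q] [Fintype Q] (f : P → Q)
    (hf : ∀ x y, f x ≤ f y ↔ x ≤ y) (x : P)
    (hr : ∀ y z, f x ≤ z → z ≤ f y → ∃ z', f z' = z) (y : P) (hxy : x ≤ y) :
    mu (f x) (f y) = mu x y := by
  have hinj : Function.Injective f := fun a b h =>
    le_antisymm ((hf a b).1 h.le) ((hf b a).1 h.ge)
  refine mu_unique (fun y => mu (f x) (f y)) x (mu_self _) ?_ y hxy
  intro y hy
  have h' : f x < f y := lt_of_le_of_ne ((hf _ _).2 hy.le) (fun h => hy.ne (hinj h))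
  rw [← mu_sum_right _ _ h']
  refine Finset.sum_bij (fun z _ => f z) ?_ ?_ ?_ ?_
  · intro z hz; simpa [hf] using hz
  · intro a _ b _ h; exact hinj h
  · intro z hz
    simp at hz
    obtain ⟨z', rfl⟩ := hr y z hz.1 hz.2
    refine ⟨z', ?_, rfl⟩
    simpa [hf] using hz
  · intros; rfl

theorem mu_prod {Q : Type*} [PartialOrder Q] [Fintype Q] (x y : P × Q) (hxy : x ≤ y) :
    mu x y = mu x.1 y.1 * mu x.2 y.2 := by
  symm
  refine mu_unique (fun y : P × Q => mu x.1 y.1 * mu x.2 y.2) x (by simp [mu_self]) ?_ y hxy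
  intro y hy
  rw [Finset.sum_congr (s₂ := (Finset.univ.filter (fun z : P => x.1 ≤ z ∧ z ≤ y.1)) ×ˢ
      (Finset.univ.filter (fun z : Q => x.2 ≤ z ∧ z ≤ y.2)))
      (by ext ⟨a, b⟩; simp [Prod.le_def]; tauto) (fun _ _ => rfl), Finset.sum_product, ← Finset.sum_mul_sum]
  rcases Prod.lt_iff.1 hy with h | h
  · rw [mu_sum_right _ _ h.1, zero_mul]
  · rw [mu_sum_right _ _ h.2, mul_zero]

end Mu

section MuLat
variable {L : Type*} [Lattice L] [Fintype L]

/-- Weisner theorem. -/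
theorem weisner_inf (a u : L) (hau : a < u) : ∀ f : L, f ≤ a →
    ∑ x with x ≤ u ∧ x ⊓ a = f, mu x u = 0 := by
  intro f
  induction f using WellFoundedGT.induction with
  | _ f ih =>
    intro hf
    have key := mu_sum_left f u (lt_of_le_of_lt hf hau)
    rw [← Finset.sum_fiberwise_of_maps_to
      (t := Finset.univ.filter (fun g => f ≤ g ∧ g ≤ a)) (g := fun x => x ⊓ a)] at key
    · have hmem : f ∈ Finset.univ.filter (fun g => f ≤ g ∧ g ≤ a) := by simp [hf]
      rw [← Finset.add_sum_erase _ _ hmem, Finset.sum_eq_zero (s := Finset.erase _ _),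
        add_zero] at key
      · rw [← key]
        apply Finset.sum_congr _ (fun _ _ => rfl)
        ext x
        simp only [Finset.mem_filter, Finset.mem_univ, true_and]
        constructor
        · rintro ⟨h1, h2⟩; exact ⟨⟨h2 ▸ inf_le_left, h1⟩, h2⟩
        · rintro ⟨⟨h0, h1⟩, h2⟩; exact ⟨h1, h2⟩
      · intro g hg
        simp at hg
        rw [← ih g (lt_of_le_of_ne hg.2.1 (Ne.symm hg.1)) hg.2.2]
        apply Finset.sum_congr _ (fun _ _ => rfl)
        ext x
        simp only [Finset.mem_filter, Finset.mem_univ, true_and]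
        constructor
        · rintro ⟨⟨h0, h1⟩, h2⟩; exact ⟨h1, h2⟩
        · rintro ⟨h1, h2⟩; exact ⟨⟨hg.2.1.trans (h2 ▸ inf_le_left), h1⟩, h2⟩
    · intro x hx
      simp at hx ⊢
      exact ⟨hx.1, hf⟩

theorem weisner_sup (e a : L) (hea : e < a) : ∀ f : L, a ≤ f →
    ∑ x with e ≤ x ∧ x ⊔ a = f, mu e x = 0 := by
  intro f
  induction f using WellFoundedLT.induction with
  | _ f ih =>
    intro hf
    have key := mu_sum_right e f (lt_of_lt_of_le hea hf)
    rw [← Finset.sum_fiberwise_of_maps_to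
      (t := Finset.univ.filter (fun g => a ≤ g ∧ g ≤ f)) (g := fun x => x ⊔ a)] at key
    · have hmem : f ∈ Finset.univ.filter (fun g => a ≤ g ∧ g ≤ f) := by simp [hf]
      rw [← Finset.add_sum_erase _ _ hmem, Finset.sum_eq_zero (s := Finset.erase _ _),
        add_zero] at key
      · rw [← key]
        apply Finset.sum_congr _ (fun _ _ => rfl)
        ext x
        simp only [Finset.mem_filter, Finset.mem_univ, true_and]
        constructor
        · rintro ⟨h1, h2⟩; exact ⟨⟨h1, h2 ▸ le_sup_left⟩, h2⟩
        · rintro ⟨⟨h0, h1⟩, h2⟩; exact ⟨h0, h2⟩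
      · intro g hg
        simp at hg
        rw [← ih g (lt_of_le_of_ne hg.2.2 hg.1) hg.2.1]
        apply Finset.sum_congr _ (fun _ _ => rfl)
        ext x
        simp only [Finset.mem_filter, Finset.mem_univ, true_and]
        constructor
        · rintro ⟨⟨h0, h1⟩, h2⟩; exact ⟨h0, h2⟩
        · rintro ⟨h1, h2⟩
          exact ⟨⟨h1, le_trans (h2 ▸ le_sup_left) hg.2.2⟩, h2⟩
    · intro x hx
      simp at hx ⊢
      exact ⟨hx.2, hf⟩

variable [IsModularLattice L]

theorem mu_diamond (x h : L) : mu (x ⊓ h) h = mu x (x ⊔ h) := by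
  let P := Set.Icc (x ⊓ h) h
  have hle : x ⊓ h ≤ h := inf_le_right
  have e1 := mu_embed (P := P) (Q := L) (fun z => z.1) (fun _ _ => Iff.rfl)
    ⟨x ⊓ h, le_rfl, hle⟩ (fun y z h1 h2 => ⟨⟨z, h1, h2.trans y.2.2⟩, rfl⟩)
    ⟨h, hle, le_rfl⟩ hle
  have e2 := mu_embed (P := P) (Q := L) (fun z => (infIccOrderIsoIccSup' x h z).1)
    (fun a b => (infIccOrderIsoIccSup' x h).le_iff_le)
    ⟨x ⊓ h, le_rfl, hle⟩ (fun y z h1 h2 => by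
      refine ⟨(infIccOrderIsoIccSup' x h).symm ⟨z, le_trans ?_ h1, h2.trans ?_⟩, ?_⟩
      · exact (infIccOrderIsoIccSup' x h _).2.1
      · exact (infIccOrderIsoIccSup' x h _).2.2
      · simp)
    ⟨h, hle, le_rfl⟩ hle
  simp only at e1
  rw [e1, ← e2]
  simp [infIccOrderIsoIccSup', infIccOrderIsoIccSup, sup_comm]

end MuLat
end MomentAux

namespace MomentAux

/-- The interval `[y, x]` is complemented. -/
def Ss {P : Type*} [PartialOrder P] (y x : P) : Prop :=
  ∀ z, y ≤ z → z ≤ x → ∃ w, IsLUB {z, w} x ∧ IsGLB {z, w} y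

/-- The interval `[e, x]` has Loewy length at most `i`. -/
def LL {P : Type*} [PartialOrder P] : ℕ → P → P → Prop
  | 0, e, x => x = e
  | (i+1), e, x => ∃ y, e ≤ y ∧ y ≤ x ∧ LL i e y ∧ Ss y x

theorem LL_le {P : Type*} [PartialOrder P] (i : ℕ) {e x : P} (h : LL i e x) : e ≤ x := by
  cases i with
  | zero => exact h.ge
  | succ i => obtain ⟨y, h1, h2, _⟩ := h; exact h1.trans h2

theorem isLUB_pair_iff {L : Type*} [Lattice L] {a b c : L} : IsLUB {a, b} c ↔ a ⊔ b = c :=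
  ⟨fun h => isLUB_pair.unique h, fun h => h ▸ isLUB_pair⟩

theorem isGLB_pair_iff {L : Type*} [Lattice L] {a b c : L} : IsGLB {a, b} c ↔ a ⊓ b = c :=
  ⟨fun h => isGLB_pair.unique h, fun h => h ▸ isGLB_pair⟩

section Lat
variable {L : Type*} [Lattice L]

theorem Ss_iff {y x : L} : Ss y x ↔ ∀ z, y ≤ z → z ≤ x → ∃ w, z ⊔ w = x ∧ z ⊓ w = y := by
  simp only [Ss, isLUB_pair_iff, isGLB_pair_iff]

theorem Ss_dual {y x : L} : Ss (OrderDual.toDual x) (OrderDual.toDual y) ↔ Ss y x := by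
  rw [Ss_iff, Ss_iff]
  constructor
  · intro h z h1 h2
    obtain ⟨w, hw1, hw2⟩ := h (OrderDual.toDual z) h2 h1
    exact ⟨OrderDual.ofDual w, hw2, hw1⟩
  · intro h z h1 h2
    obtain ⟨w, hw1, hw2⟩ := h (OrderDual.ofDual z) h2 h1
    exact ⟨OrderDual.toDual w, hw2, hw1⟩

theorem Ss_refl (x : L) : Ss x x := by
  rw [Ss_iff]
  intro z h1 h2
  obtain rfl := le_antisymm h1 h2
  exact ⟨x, by simp⟩

variable [IsModularLattice L]

theorem Ss_sub {y x y' x' : L} (h : Ss y x) (h1 : y ≤ y') (h2 : x' ≤ x) : Ss y' x' := by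
  rw [Ss_iff] at *
  intro z hz1 hz2
  obtain ⟨w, hw1, hw2⟩ := h z (h1.trans hz1) (hz2.trans h2)
  refine ⟨(w ⊓ x') ⊔ y', ?_, ?_⟩
  · rw [sup_comm _ y', ← sup_assoc, sup_eq_left.2 hz1, ← sup_inf_assoc_of_le _ hz2, hw1]
    exact inf_eq_right.2 h2
  · rw [inf_comm, sup_comm, sup_inf_assoc_of_le _ hz1]
    apply le_antisymm
    · refine sup_le le_rfl ?_
      calc w ⊓ x' ⊓ z ≤ z ⊓ w := by
            exact le_inf inf_le_right (inf_le_left.trans inf_le_left)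
        _ ≤ y' := hw2.le.trans h1
    · exact le_sup_left

theorem Ss_up {a b : L} (h : Ss (a ⊓ b) a) : Ss b (a ⊔ b) := by
  rw [Ss_iff] at *
  intro z hz1 hz2
  obtain ⟨w, hw1, hw2⟩ := h (z ⊓ a) (by rw [inf_comm]; exact inf_le_inf_right _ hz1) inf_le_right
  have hz : (z ⊓ a) ⊔ b = z := by
    rw [sup_comm, inf_comm, ← sup_inf_assoc_of_le _ hz1, sup_comm]
    exact inf_eq_right.2 hz2
  have hwa : w ≤ a := hw1 ▸ le_sup_right
  refine ⟨w ⊔ b, ?_, ?_⟩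
  · apply le_antisymm
    · exact sup_le hz2 (sup_le_sup_right hwa _)
    · rw [← hw1]
      exact sup_le (sup_le (inf_le_left.trans le_sup_left) (le_sup_left.trans le_sup_right))
        (le_sup_right.trans le_sup_right)
  · rw [inf_comm, sup_comm, sup_inf_assoc_of_le _ hz1]
    apply le_antisymm
    · refine sup_le le_rfl ?_
      have : w ⊓ z ≤ z ⊓ a ⊓ w := le_inf (le_inf inf_le_right (inf_le_left.trans hwa)) inf_le_left
      exact this.trans (hw2.le.trans inf_le_right)
    · exact le_sup_left

theorem Ss_down {a b : L} (h : Ss b (a ⊔ b)) : Ss (a ⊓ b) a := by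
  rw [← Ss_dual] at h ⊢
  have := Ss_up (a := OrderDual.toDual b) (b := OrderDual.toDual a)
    (by rw [← toDual_sup, sup_comm]; exact h)
  rw [← toDual_inf, inf_comm] at this
  exact this

theorem Ss_join {b x₁ x₂ : L} (h1 : Ss b x₁) (h2 : Ss b x₂) (hb1 : b ≤ x₁) (hb2 : b ≤ x₂) :
    Ss b (x₁ ⊔ x₂) := by
  rw [Ss_iff] at *
  intro z hz1 hz2
  obtain ⟨w1, hw1, hw1'⟩ := h1 (z ⊓ x₁) (le_inf hz1 hb1) inf_le_right
  obtain ⟨w2, hw2, hw2'⟩ := h2 ((z ⊔ w1) ⊓ x₂) (le_inf (hz1.trans le_sup_left) hb2) inf_le_right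
  have hw1x : w1 ≤ x₁ := hw1 ▸ le_sup_right
  have hw2x : w2 ≤ x₂ := hw2 ▸ le_sup_right
  have hbw1 : b ≤ w1 := hw1' ▸ inf_le_right
  refine ⟨w1 ⊔ w2, ?_, ?_⟩
  · apply le_antisymm
    · exact sup_le hz2 (sup_le_sup hw1x hw2x)
    · refine sup_le ?_ ?_
      · rw [← hw1]
        exact sup_le (inf_le_left.trans le_sup_left) (le_sup_left.trans le_sup_right)
      · rw [← hw2]
        refine sup_le (inf_le_left.trans ?_) (le_sup_right.trans le_sup_right)
        exact sup_le_sup_left le_sup_left _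
  · apply le_antisymm
    · have e1 : z ⊓ (w1 ⊔ w2) ≤ w1 := by
        calc z ⊓ (w1 ⊔ w2) ≤ (w1 ⊔ w2) ⊓ (z ⊔ w1) := 
              le_inf inf_le_right (inf_le_left.trans le_sup_left)
          _ = w1 ⊔ w2 ⊓ (z ⊔ w1) := sup_inf_assoc_of_le _ le_sup_right
          _ ≤ w1 := by
              refine sup_le le_rfl ?_
              have : w2 ⊓ (z ⊔ w1) ≤ (z ⊔ w1) ⊓ x₂ ⊓ w2 :=
                le_inf (le_inf inf_le_right (inf_le_left.trans hw2x)) inf_le_left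
              exact this.trans (hw2'.le.trans hbw1)
      rw [← hw1']
      exact le_inf (le_inf inf_le_left (e1.trans hw1x)) e1
    · exact le_inf hz1 (hbw1.trans le_sup_left)

theorem Ss_meet {b x₁ x₂ : L} (h1 : Ss x₁ b) (h2 : Ss x₂ b) (hb1 : x₁ ≤ b) (hb2 : x₂ ≤ b) :
    Ss (x₁ ⊓ x₂) b := by
  rw [← Ss_dual] at h1 h2 ⊢
  exact Ss_join h1 h2 hb1 hb2

theorem LL_mono (i : ℕ) : ∀ {e x y : L}, LL i e x → e ≤ y → y ≤ x → LL i e y := by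
  induction i with
  | zero => 
    intro e x y h1 h2 h3
    exact le_antisymm (h3.trans h1.le) h2
  | succ i ih =>
    rintro e x y ⟨c, hc1, hc2, hc3, hc4⟩ h2 h3
    refine ⟨y ⊓ c, le_inf h2 hc1, inf_le_left, ih hc3 (le_inf h2 hc1) inf_le_right, ?_⟩
    apply Ss_down
    exact Ss_sub hc4 le_rfl (sup_le h3 hc2)

theorem LL_join (i : ℕ) : ∀ {e x y : L}, LL i e x → LL i e y → LL i e (x ⊔ y) := by
  induction i with
  | zero => 
    rintro e x y h1 h2
    change x = e at h1
    change y = e at h2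
    change x ⊔ y = e
    rw [h1, h2, sup_idem]
  | succ i ih =>
    rintro e x y ⟨c, hc1, hc2, hc3, hc4⟩ ⟨d, hd1, hd2, hd3, hd4⟩
    refine ⟨c ⊔ d, hc1.trans le_sup_left, sup_le_sup hc2 hd2, ih hc3 hd3, ?_⟩
    have h1 : Ss (c ⊔ d) (x ⊔ (c ⊔ d)) := Ss_up (Ss_sub hc4 (le_inf hc2 le_sup_left) le_rfl)
    have h2 : Ss (c ⊔ d) (y ⊔ (c ⊔ d)) := Ss_up (Ss_sub hd4 (le_inf hd2 le_sup_right) le_rfl)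
    have := Ss_join h1 h2 le_sup_right le_sup_right
    refine Ss_sub this le_rfl ?_
    exact sup_le_sup le_sup_left le_sup_left

theorem LL_self (i : ℕ) (e : L) : LL i e e := by
  induction i with
  | zero => rfl
  | succ i ih => exact ⟨e, le_rfl, le_rfl, ih, Ss_refl e⟩

theorem LL_succ (i : ℕ) {e x : L} (h : LL i e x) : LL (i+1) e x :=
  ⟨x, LL_le i h, le_rfl, h, Ss_refl x⟩

theorem exists_greatest_LL [Finite L] (i : ℕ) (e : L) : ∃ A, IsGreatest {x | LL i e x} A := by
  obtain ⟨A, hA, hmax⟩ := Set.Finite.exists_maximal (Set.toFinite {x | LL i e x}) ⟨e, LL_self i e⟩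
  refine ⟨A, hA, fun x hx => ?_⟩
  have := hmax (y := A ⊔ x) (LL_join i hA hx) le_sup_left
  exact le_sup_right.trans this

/-- The relation of a greatest element below `a`. -/
theorem greatest_LL_below (i : ℕ) {e A : L} (hA : IsGreatest {x | LL i e x} A) {a b : L}
    (hea : e ≤ a) : IsGreatest {x | x ≤ a ∧ LL i e x} b ↔ a ⊓ A = b := by
  have : IsGreatest {x | x ≤ a ∧ LL i e x} (a ⊓ A) := 
    ⟨⟨inf_le_left, LL_mono i hA.1 (le_inf hea (LL_le i hA.1)) inf_le_right⟩,
      fun x hx => le_inf hx.1 (hA.2 hx.2)⟩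
  exact ⟨fun h => this.unique h, fun h => h ▸ this⟩

theorem Ss_of_greatest (i : ℕ) {e A t : L} (hA : IsGreatest {x | LL i e x} A)
    (ht : LL (i+1) e t) : Ss A t := by
  obtain ⟨c, hc1, hc2, hc3, hc4⟩ := ht
  exact Ss_sub hc4 (hA.2 hc3) le_rfl

theorem Ss_of_mu_ne_zero [Fintype L] {e u : L} (hle : e ≤ u) (h : mu e u ≠ 0) : Ss e u := by
  by_contra hns
  obtain ⟨R, hR, hmin⟩ := Set.Finite.exists_minimal
    (Set.toFinite {x : L | e ≤ x ∧ x ≤ u ∧ Ss x u}) ⟨u, hle, le_rfl, Ss_refl u⟩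
  obtain ⟨hR1, hR2, hR3⟩ := hR
  have hRe : e < R := lt_of_le_of_ne hR1 (by rintro rfl; exact hns hR3)
  have key := weisner_sup e R hRe u hR2
  rw [Finset.sum_eq_single u] at key
  · exact h key
  · intro x hx hxu
    exfalso
    simp only [Finset.mem_filter, Finset.mem_univ, true_and] at hx
    have hxlt : x < u := lt_of_le_of_ne (hx.2 ▸ le_sup_left) hxu
    obtain ⟨c, hc, hcmax⟩ := Set.Finite.exists_maximal
      (Set.toFinite {y : L | x ≤ y ∧ y < u}) ⟨x, le_rfl, hxlt⟩
    have hcS : Ss c u := by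
      rw [Ss_iff]
      intro z hz1 hz2
      rcases hz2.eq_or_lt with rfl | hz
      · exact ⟨c, sup_eq_left.2 hz1, inf_eq_right.2 hz1⟩
      · have := hcmax (y := z) ⟨hc.1.trans hz1, hz⟩ hz1
        obtain rfl := le_antisymm hz1 this
        exact ⟨u, sup_eq_right.2 hz2, inf_eq_left.2 hz2⟩
    have h1 := Ss_meet hR3 hcS hR2 hc.2.le
    have h2 := hmin (y := R ⊓ c) ⟨le_inf hR1 (hx.1.trans hc.1), inf_le_left.trans hR2, h1⟩
      inf_le_left
    have h3 : R ≤ c := h2.trans inf_le_right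
    have h4 : u ≤ c := hx.2 ▸ sup_le hc.1 h3
    exact absurd hc.2 (not_lt_of_ge h4)
  · intro hu
    exfalso
    apply hu
    simp [hle, hR2]

end Lat
end MomentAux

namespace MomentAux

/-- every interval of length two which is not a chain has at least three middle elements -/
def Thick (L : Type*) [Lattice L] : Prop :=
  ∀ y a b : L, y ⋖ a → y ⋖ b → a ≠ b → ∃ c, y ⋖ c ∧ c ≠ a ∧ c ≠ b ∧ c ≤ a ⊔ b

/-- elements of `[⊥,u]` not below `h` meeting `h` in `y` -/
noncomputable def Nset {L : Type*} [Lattice L] [Fintype L] (h u y : L) : Finset L :=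
  Finset.univ.filter (fun x => x ≤ u ∧ ¬ x ≤ h ∧ x ⊓ h = y)

section
variable {L : Type*} [Lattice L] [Fintype L]

theorem mem_Nset {h u y x : L} : x ∈ Nset h u y ↔ x ≤ u ∧ ¬ x ≤ h ∧ x ⊓ h = y := by
  simp [Nset]

theorem sup_of_Nset {h u y x : L} (hu : h ⋖ u) (hx : x ∈ Nset h u y) : x ⊔ h = u := by
  rw [mem_Nset] at hx
  have h1 : h < x ⊔ h := lt_of_le_of_ne le_sup_right (fun e => hx.2.1 (e ▸ le_sup_left))
  by_contra hne
  exact hu.2 h1 (lt_of_le_of_ne (sup_le hx.1 hu.1.le) hne)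

variable [IsModularLattice L]

theorem mu_of_Nset {h u y x : L} (hu : h ⋖ u) (hx : x ∈ Nset h u y) : mu x u = mu y h := by
  have h1 := sup_of_Nset hu hx
  rw [mem_Nset] at hx
  rw [← h1, ← mu_diamond, hx.2.2]

theorem cov_of_Nset {h u y x : L} (hu : h ⋖ u) (hx : x ∈ Nset h u y) : y ⋖ x := by
  have h1 := sup_of_Nset hu hx
  rw [mem_Nset] at hx
  rw [← hx.2.2]
  apply inf_covBy_of_covBy_sup_right
  rw [h1]; exact hu

theorem mu_coatom {h u y : L} (hu : h ⋖ u) (hy : y ≤ h) :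
    mu y u = - ((Nset h u y).card * mu y h) := by
  have key := weisner_inf h u hu.1 y hy
  have : (Finset.univ.filter (fun x => x ≤ u ∧ x ⊓ h = y)) = insert y (Nset h u y) := by
    ext x
    simp only [Finset.mem_filter, Finset.mem_univ, true_and, Finset.mem_insert, mem_Nset]
    constructor
    · rintro ⟨h1, h2⟩
      by_cases hx : x ≤ h
      · left; rw [← h2]; exact (inf_eq_left.2 hx).symm
      · right; exact ⟨h1, hx, h2⟩
    · rintro (rfl | h1)
      · exact ⟨hy.trans hu.1.le, inf_eq_left.2 hy⟩
      · exact ⟨h1.1, h1.2.2⟩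
  rw [this, Finset.sum_insert (by rw [mem_Nset]; exact fun h => h.2.1 hy),
    Finset.sum_congr rfl (fun x hx => mu_of_Nset hu hx), Finset.sum_const, nsmul_eq_mul] at key
  linarith

theorem abs_mu_coatom {h u y : L} (hu : h ⋖ u) (hy : y ≤ h) :
    |mu y u| = (Nset h u y).card * |mu y h| := by
  rw [mu_coatom hu hy, abs_neg, abs_mul, Nat.abs_cast]

variable [BoundedOrder L] [ComplementedLattice L]

theorem Nset_decay (ht : Thick L) {h u y y' : L} (hu : h ⋖ u) (hy : y ⋖ y') (hy' : y' ≤ h) :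
    2 * (Nset h u y').card ≤ (Nset h u y).card := by
  have hmaps : ∀ x ∈ Nset h u y, x ⊔ y' ∈ Nset h u y' := by
    intro x hx
    have hs := sup_of_Nset hu hx
    rw [mem_Nset] at hx ⊢
    refine ⟨sup_le hx.1 (hy'.trans hu.1.le), fun hh => hx.2.1 (le_sup_left.trans hh), ?_⟩
    rw [sup_comm, sup_inf_assoc_of_le _ hy', hx.2.2]
    exact sup_eq_left.2 hy.1.le
  have hcard := Finset.card_eq_sum_card_fiberwise hmaps
  rw [hcard, mul_comm, ← smul_eq_mul]
  apply Finset.card_nsmul_le_sum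
  intro x' hx'
  have hcov := cov_of_Nset hu hx'
  rw [mem_Nset] at hx'
  obtain ⟨hx1, hx2, hx3⟩ := hx'
  have hgen : ∀ x, x ⊓ y' = y → x ⊔ y' = x' →
      x ∈ (Nset h u y).filter (fun x => x ⊔ y' = x') := by
    intro x h1 h2
    rw [Finset.mem_filter, mem_Nset]
    refine ⟨⟨le_trans (h2 ▸ le_sup_left) hx1, fun hh => hx2 (h2 ▸ sup_le hh hy'), ?_⟩, h2⟩
    have hxx : x ≤ x' := h2 ▸ le_sup_left
    rw [← h1, ← hx3, ← inf_assoc, inf_eq_left.2 hxx]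
  obtain ⟨x, e1, e2⟩ := IsModularLattice.exists_inf_eq_and_sup_eq hy.1.le hcov.1.le
  rw [inf_comm] at e1
  rw [sup_comm] at e2
  have hyx : y ⋖ x := by
    rw [← e1]
    apply inf_covBy_of_covBy_sup_right
    rw [e2]; exact hcov
  have hne : y' ≠ x := by
    rintro rfl
    rw [inf_idem] at e1
    exact hy.1.ne e1.symm
  obtain ⟨c, c1, c2, c3, c4⟩ := ht y y' x hy hyx hne
  rw [sup_comm, e2] at c4
  have hcy : ¬ c ≤ y' := fun hh => hy.2 c1.1 (lt_of_le_of_ne hh c2)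
  have d2 : c ⊔ y' = x' := by
    by_contra hne'
    exact hcov.2 (lt_of_le_of_ne le_sup_right (fun e => hcy (e ▸ le_sup_left)))
      (lt_of_le_of_ne (sup_le c4 hcov.1.le) hne')
  have d1 : c ⊓ y' = y := by
    by_contra hne'
    exact c1.2 (lt_of_le_of_ne (le_inf c1.1.le hy.1.le) (Ne.symm hne'))
      (lt_of_le_of_ne inf_le_left (fun e => hcy (inf_eq_left.1 e)))
  have : ({x, c} : Finset L) ⊆ (Nset h u y).filter (fun x => x ⊔ y' = x') := by
    intro z hz
    simp only [Finset.mem_insert, Finset.mem_singleton] at hz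
    rcases hz with rfl | rfl
    · exact hgen _ e1 e2
    · exact hgen _ d1 d2
  calc 2 = ({x, c} : Finset L).card := (Finset.card_pair c3.symm).symm
    _ ≤ _ := Finset.card_le_card this

theorem thick_bound (ht : Thick L) : ∀ (u : L) (t : ℝ) (w : L → ℝ), 0 ≤ t → (∀ x, 0 ≤ w x) →
    (∀ y x, y ⋖ x → x ≤ u → w x ≤ t * w y) →
    ∑ x with x ≤ u, w x * |mu x u| ≤ Real.exp (2 * t) * (w ⊥ * |mu ⊥ u|) := by
  intro u
  induction u using WellFoundedLT.induction with
  | _ u ih =>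
    intro t w ht0 hw hdec
    rcases eq_or_ne u ⊥ with rfl | hu0
    · have : (Finset.univ.filter (fun x : L => x ≤ ⊥)) = {⊥} := by ext x; simp
      rw [this, Finset.sum_singleton]
      have h1 : (1 : ℝ) ≤ Real.exp (2 * t) := Real.one_le_exp (by linarith)
      have h2 : 0 ≤ w ⊥ * |mu (⊥ : L) ⊥| := mul_nonneg (hw _) (abs_nonneg _)
      nlinarith
    · obtain ⟨h, hh, hmax⟩ := Set.Finite.exists_maximal
        (Set.toFinite {y : L | y < u}) ⟨⊥, bot_lt_iff_ne_bot.2 hu0⟩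
      have hu : h ⋖ u := ⟨hh, fun c h1 h2 => absurd (hmax (y := c) h2 h1.le) (not_le_of_gt h1)⟩
      have IH := ih h hu.1 (t / 2) (fun y => w y * (Nset h u y).card) (by linarith)
        (fun x => mul_nonneg (hw x) (Nat.cast_nonneg _)) (by
          intro y x hyx hxh
          have e1 := Nset_decay ht hu hyx hxh
          have e2 : 2 * ((Nset h u x).card : ℝ) ≤ ((Nset h u y).card : ℝ) := by exact_mod_cast e1
          have e3 := hdec y x hyx (hxh.trans hu.1.le)
          have e4 := hw y
          have e5 : (0 : ℝ) ≤ (Nset h u x).card := Nat.cast_nonneg _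
          calc w x * ((Nset h u x).card : ℝ) ≤ t * w y * (Nset h u x).card :=
                mul_le_mul_of_nonneg_right e3 e5
            _ ≤ t * w y * ((Nset h u y).card / 2) :=
                mul_le_mul_of_nonneg_left (by linarith) (mul_nonneg ht0 e4)
            _ = _ := by ring)
      have split : ∑ x with x ≤ u, w x * |mu x u| =
          ∑ x with x ≤ h, w x * |mu x u| + ∑ x with x ≤ u ∧ ¬ x ≤ h, w x * |mu x u| := by
        rw [← Finset.sum_filter_add_sum_filter_not _ (fun x => x ≤ h)]
        congr 1
        · apply Finset.sum_congr _ (fun _ _ => rfl)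
          ext x; simp only [Finset.mem_filter, Finset.mem_univ, true_and]
          exact ⟨fun k => k.2, fun k => ⟨k.trans hu.1.le, k⟩⟩
        · apply Finset.sum_congr _ (fun _ _ => rfl)
          ext x; simp
      have first : ∑ x with x ≤ h, w x * |mu x u|
          = ∑ y with y ≤ h, w y * (Nset h u y).card * |mu y h| := by
        apply Finset.sum_congr rfl
        intro y hy
        simp at hy
        rw [abs_mu_coatom hu hy]; ring
      have second : ∑ x with x ≤ u ∧ ¬ x ≤ h, w x * |mu x u|
          ≤ t * ∑ y with y ≤ h, w y * (Nset h u y).card * |mu y h| := by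
        rw [← Finset.sum_fiberwise_of_maps_to
          (t := Finset.univ.filter (fun y => y ≤ h)) (g := fun x => x ⊓ h), Finset.mul_sum]
        · apply Finset.sum_le_sum
          intro y hy
          have : (Finset.univ.filter (fun x => x ≤ u ∧ ¬ x ≤ h)).filter (fun x => x ⊓ h = y)
              = Nset h u y := by
            ext x; simp [mem_Nset, and_assoc]
          rw [this]
          calc ∑ x ∈ Nset h u y, w x * |mu x u| ≤ ∑ x ∈ Nset h u y, t * w y * |mu y h| := by
                apply Finset.sum_le_sum
                intro x hx
                rw [mu_of_Nset hu hx]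
                exact mul_le_mul_of_nonneg_right
                  (hdec y x (cov_of_Nset hu hx) (mem_Nset.1 hx).1) (abs_nonneg _)
            _ = _ := by rw [Finset.sum_const, nsmul_eq_mul]; ring
        · intro x hx
          simp
      rw [split, first]
      have e0 : (0:ℝ) ≤ w ⊥ * |mu (⊥ : L) u| := mul_nonneg (hw _) (abs_nonneg _)
      have e1 : ∑ y with y ≤ h, w y * (Nset h u y).card * |mu y h|
          ≤ Real.exp t * (w ⊥ * |mu (⊥ : L) u|) := by
        rw [abs_mu_coatom hu bot_le]
        calc _ ≤ _ := IH
          _ = _ := by rw [show 2 * (t / 2) = t by ring]; ring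
      have e2 : 1 + t ≤ Real.exp t := by linarith [Real.add_one_le_exp t]
      calc _ ≤ (1 + t) * ∑ y with y ≤ h, w y * (Nset h u y).card * |mu y h| := by linarith
        _ ≤ (1 + t) * (Real.exp t * (w ⊥ * |mu (⊥ : L) u|)) :=
            mul_le_mul_of_nonneg_left e1 (by linarith)
        _ ≤ Real.exp t * (Real.exp t * (w ⊥ * |mu (⊥ : L) u|)) :=
            mul_le_mul_of_nonneg_right e2 (mul_nonneg (Real.exp_pos _).le e0)
        _ = _ := by rw [two_mul, Real.exp_add]; ring

theorem thick_bound_one (ht : Thick L) : 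
    ∑ x : L, |mu x ⊤| ≤ 8 * |mu (⊥ : L) ⊤| := by
  have := thick_bound ht ⊤ 1 (fun _ => 1) zero_le_one (fun _ => zero_le_one) (by simp)
  simp only [le_top, Finset.filter_true, one_mul, mul_one] at this
  refine this.trans (mul_le_mul_of_nonneg_right ?_ (abs_nonneg _))
  have h := Real.exp_one_lt_d9
  have h0 := Real.exp_pos 1
  rw [show (2:ℝ) = 1 + 1 by norm_num, Real.exp_add]
  nlinarith

end
end MomentAux

namespace MomentAux

/-- number of distributive elements -/
noncomputable def Zl (L : Type*) [Lattice L] : ℕ :=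
  Nat.card {H : L // ∀ K₁ K₂ : L, H ⊔ (K₁ ⊓ K₂) = (H ⊔ K₁) ⊓ (H ⊔ K₂)}

/-- perspectivity of atoms -/
def Persp {L : Type*} [Lattice L] [OrderBot L] (p q : L) : Prop :=
  p = q ∨ ∃ r, IsAtom r ∧ r ≠ p ∧ r ≠ q ∧ r ≤ p ⊔ q

section
variable {L : Type*} [Lattice L] [Fintype L] [BoundedOrder L]

theorem exists_atom_le {x : L} (hx : x ≠ ⊥) : ∃ p, IsAtom p ∧ p ≤ x := by
  rcases eq_bot_or_exists_atom_le x with h | h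
  · exact absurd h hx
  · exact h

theorem Persp.symm' {p q : L} (h : Persp p q) : Persp q p := by
  rcases h with rfl | ⟨r, h1, h2, h3, h4⟩
  · exact Or.inl rfl
  · exact Or.inr ⟨r, h1, h3, h2, by rwa [sup_comm]⟩

variable [IsModularLattice L]

theorem atom_cov {p x : L} (hp : IsAtom p) (h : ¬ p ≤ x) : x ⋖ p ⊔ x := by
  apply covBy_sup_of_inf_covBy_left
  have h0 : p ⊓ x = ⊥ := by
    rcases hp.le_iff.1 (inf_le_left : p ⊓ x ≤ p) with h1 | h1
    · exact h1
    · exact absurd (inf_eq_left.1 h1) h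
  rw [h0]
  exact hp.bot_covBy

theorem line_eq {a b u v : L} (ha : IsAtom a) (hb : IsAtom b)
    (hu : IsAtom u) (hv : IsAtom v) (huv : u ≠ v) (hu' : u ≤ a ⊔ b) (hv' : v ≤ a ⊔ b) :
    u ⊔ v = a ⊔ b := by
  have not_le : ∀ {p q : L}, IsAtom p → IsAtom q → p ≠ q → ¬ p ≤ q := fun hp hq hne h =>
    hne (hq.le_iff_eq hp.1 |>.1 h)
  have exch : ∀ {a b u : L}, IsAtom a → IsAtom b → IsAtom u → u ≤ a ⊔ b → u ≠ b →
      u ⊔ b = a ⊔ b := by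
    intro a b u ha hb hu h1 h2
    by_cases hab : a ≤ b
    · exfalso
      rw [sup_eq_right.2 hab] at h1
      exact not_le hu hb h2 h1
    · have c := atom_cov ha hab
      by_contra hne
      exact c.2 (lt_of_le_of_ne le_sup_right
        (fun e => not_le hu hb h2 (e ▸ le_sup_left)))
        (lt_of_le_of_ne (sup_le h1 le_sup_right) hne)
  by_cases hub : u = b
  · subst hub
    rw [sup_comm]; exact exch ha hu hv hv' huv.symm
  · have e1 := exch ha hb hu hu' hub
    rw [← e1] at hv' ⊢
    rw [sup_comm u b] at hv' ⊢
    rw [sup_comm u v]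
    exact exch hb hu hv hv' huv.symm

theorem not_le_of_atoms {p q : L} (hp : IsAtom p) (hq : IsAtom q) (hne : p ≠ q) : ¬ p ≤ q :=
  fun h => hne ((hq.le_iff_eq hp.1).1 h)

theorem persp_trans {p q r : L} (hp : IsAtom p) (hq : IsAtom q) (hr : IsAtom r)
    (h1 : Persp p q) (h2 : Persp q r) : Persp p r := by
  by_cases hpr : p = r
  · exact Or.inl hpr
  rcases h1 with rfl | ⟨a, ha, hap, haq, hale⟩
  · exact h2
  rcases h2 with rfl | ⟨b, hb, hbq, hbr, hble⟩
  · exact Or.inr ⟨a, ha, hap, haq, hale⟩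
  by_cases hqpr : q ≤ p ⊔ r
  · by_cases hqp : q = p
    · subst hqp; exact Or.inr ⟨b, hb, hbq, hbr, hble⟩
    by_cases hqr : q = r
    · subst hqr; exact Or.inr ⟨a, ha, hap, haq, hale⟩
    exact Or.inr ⟨q, hq, hqp, hqr, hqpr⟩
  have hcov := atom_cov hq hqpr
  have lap : a ⊔ p = p ⊔ q := line_eq hp hq ha hp hap hale le_sup_left
  have lbr : b ⊔ r = q ⊔ r := line_eq hq hr hb hr hbr hble le_sup_right
  have laq : a ⊔ q = p ⊔ q := line_eq hp hq ha hq haq hale le_sup_right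
  have lbq : b ⊔ q = q ⊔ r := line_eq hq hr hb hq hbq hble le_sup_left
  have hapr : ¬ a ≤ p ⊔ r := fun h => hqpr (by
    have : q ≤ a ⊔ p := lap ▸ le_sup_right
    exact this.trans (sup_le h le_sup_left))
  have hab : a ≠ b := by
    rintro rfl
    apply hqpr
    have : p ⊔ q = q ⊔ r := laq.symm.trans lbq
    have hr' : r ≤ p ⊔ q := this ▸ le_sup_right
    rw [line_eq hp hq hp hr hpr le_sup_left hr']
    exact le_sup_right
  have hnp : ¬ p ≤ a ⊔ b := by
    intro h
    have hq' : q ≤ a ⊔ b := by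
      have : q ≤ a ⊔ p := lap ▸ le_sup_right
      exact this.trans (sup_le le_sup_left h)
    have hr' : r ≤ a ⊔ b := by
      have : r ≤ b ⊔ q := lbq ▸ le_sup_right
      exact this.trans (sup_le le_sup_right hq')
    rw [← line_eq ha hb hp hr hpr h hr'] at hq'
    exact hqpr hq'
  have hnr : ¬ r ≤ a ⊔ b := by
    intro h
    have hq' : q ≤ a ⊔ b := by
      have : q ≤ b ⊔ r := lbr ▸ le_sup_left
      exact this.trans (sup_le le_sup_right h)
    have hp' : p ≤ a ⊔ b := by
      have : p ≤ a ⊔ q := laq ▸ le_sup_left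
      exact this.trans (sup_le le_sup_left hq')
    exact hnp hp'
  have hne : (a ⊔ b) ⊓ (p ⊔ r) ≠ ⊥ := by
    intro h0
    have hP : (a ⊔ b) ⊔ (p ⊔ r) = q ⊔ (p ⊔ r) := by
      have h1 : p ⊔ r < (a ⊔ b) ⊔ (p ⊔ r) :=
        lt_of_le_of_ne le_sup_right (fun e => hapr (by rw [e]; exact le_sup_left.trans le_sup_left))
      by_contra hne
      refine hcov.2 h1 (lt_of_le_of_ne ?_ hne)
      refine sup_le (sup_le (hale.trans ?_) (hble.trans ?_)) le_sup_right
      · exact sup_le (le_sup_left.trans le_sup_right) le_sup_left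
      · exact sup_le le_sup_left (le_sup_right.trans le_sup_right)
    have c2 : (a ⊔ b) ⊓ (p ⊔ r) ⋖ a ⊔ b := by
      apply inf_covBy_of_covBy_sup_right
      rw [hP]; exact hcov
    rw [h0] at c2
    refine c2.2 (bot_lt_iff_ne_bot.2 ha.1) (lt_of_le_of_ne le_sup_left ?_)
    intro e
    exact not_le_of_atoms hb ha hab.symm (e ▸ le_sup_right)
  obtain ⟨t, ht, htle⟩ := exists_atom_le hne
  refine Or.inr ⟨t, ht, ?_, ?_, htle.trans inf_le_right⟩
  · rintro rfl; exact hnp (htle.trans inf_le_left)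
  · rintro rfl; exact hnr (htle.trans inf_le_left)

theorem persp_of_meet {p v m : L} (hp : IsAtom p) (hv : IsAtom v) (hpv : p ≠ v)
    (hle : p ≤ v ⊔ m) (hpm : ¬ p ≤ m) (hvm : ¬ v ≤ m) : Persp p v := by
  have hne : m ⊓ (p ⊔ v) ≠ ⊥ := by
    intro h0
    have : (v ⊔ m) ⊓ (p ⊔ v) = v ⊔ m ⊓ (p ⊔ v) := sup_inf_assoc_of_le _ le_sup_right
    rw [h0, sup_bot_eq, inf_eq_right.2 (sup_le hle le_sup_left)] at this
    exact not_le_of_atoms hp hv hpv (this ▸ le_sup_left)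
  obtain ⟨r, hr, hrle⟩ := exists_atom_le hne
  refine Or.inr ⟨r, hr, ?_, ?_, hrle.trans inf_le_right⟩
  · rintro rfl; exact hpm (hrle.trans inf_le_left)
  · rintro rfl; exact hvm (hrle.trans inf_le_left)

theorem persp_closed {p : L} (hp : IsAtom p) (S : Finset L)
    (hS : ∀ v ∈ S, IsAtom v ∧ Persp p v) : ∀ q, IsAtom q → q ≤ S.sup id → Persp p q := by
  induction S using Finset.induction_on with
  | empty =>
    intro q hq h
    simp at h
    exact absurd h hq.1
  | insert v S hv ih =>
    intro q hq h
    have ih' := ih (fun w hw => hS w (Finset.mem_insert_of_mem hw))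
    obtain ⟨hva, hvp⟩ := hS v (Finset.mem_insert_self _ _)
    rw [Finset.sup_insert, id] at h
    by_cases hqm : q ≤ S.sup id
    · exact ih' q hq hqm
    by_cases hvm : v ≤ S.sup id
    · rw [sup_eq_right.2 hvm] at h; exact absurd h hqm
    by_cases hqv : q = v
    · exact hqv ▸ hvp
    have := persp_of_meet hq hva hqv h hqm hvm
    exact persp_trans hp hva hq hvp this.symm'

variable [ComplementedLattice L]

theorem all_persp (h2 : ∀ a : L, a ≠ ⊥ → a ≠ ⊤ → ∃ c c', IsCompl a c ∧ IsCompl a c' ∧ c ≠ c') :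
    ∀ p q : L, IsAtom p → IsAtom q → Persp p q := by
  intro p q hp hq
  set V := Finset.univ.filter (fun v : L => IsAtom v ∧ Persp p v) with hV
  have hVm : ∀ v, v ∈ V ↔ IsAtom v ∧ Persp p v := by intro v; simp [hV]
  set z := V.sup id with hz
  have hclosed := persp_closed hp V (fun v hv => (hVm v).1 hv)
  have hpz : p ≤ z := Finset.le_sup (f := id) ((hVm p).2 ⟨hp, Or.inl rfl⟩)
  have hztop : z = ⊤ := by
    by_contra hne
    obtain ⟨c, c', hc, hc', hcc⟩ := h2 z (fun h => hp.1 (le_bot_iff.1 (h ▸ hpz))) hne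
    have hnle : ¬ c' ≤ c := by
      intro hle
      apply hcc
      symm
      exact eq_of_le_of_inf_le_of_sup_le (z := z) hle
        (by rw [hc.symm.inf_eq_bot]; exact bot_le)
        (by rw [hc'.symm.sup_eq_top]; exact le_top)
    obtain ⟨d, hd1, hd2⟩ := IsModularLattice.exists_disjoint_and_sup_eq (inf_le_left : c' ⊓ c ≤ c')
    have hd0 : d ≠ ⊥ := by
      rintro rfl
      rw [sup_bot_eq] at hd2
      exact hnle (inf_eq_left.1 hd2)
    obtain ⟨x, hx, hxd⟩ := exists_atom_le hd0
    have hxc' : x ≤ c' := hxd.trans (hd2 ▸ le_sup_right)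
    have hxc : ¬ x ≤ c := fun h => hx.1 (le_bot_iff.1 (hd1 (le_inf hxc' h) hxd))
    have hxz : ¬ x ≤ z := fun h => hx.1 (le_bot_iff.1 (hc'.disjoint h hxc'))
    have hcov := atom_cov hx hxc
    have hs1 : z ⊓ (x ⊔ c) ⊔ c = x ⊔ c := by
      have : (c ⊔ z) ⊓ (x ⊔ c) = c ⊔ z ⊓ (x ⊔ c) := sup_inf_assoc_of_le _ le_sup_right
      rw [sup_comm, ← this, hc.symm.sup_eq_top, top_inf_eq]
    have hs2 : z ⊓ (x ⊔ c) ⊓ c = ⊥ := by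
      apply le_bot_iff.1
      rw [← hc.inf_eq_bot]
      exact inf_le_inf_right _ inf_le_left
    have hsat : IsAtom (z ⊓ (x ⊔ c)) := by
      rw [← bot_covBy_iff, ← hs2]
      apply inf_covBy_of_covBy_sup_right
      rw [hs1]; exact hcov
    have hsx : x ≠ z ⊓ (x ⊔ c) := fun h => hxz (h ▸ inf_le_left)
    have hsc : ¬ z ⊓ (x ⊔ c) ≤ c := fun h => hsat.1 (by rw [← hs2]; exact (inf_eq_left.2 h).symm)
    have hper := persp_of_meet hx hsat hsx (by rw [hs1]; exact le_sup_left) hxc hsc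
    have hsV := hclosed _ hsat inf_le_left
    have hxV := persp_trans hp hsat hx hsV hper.symm'
    exact hxz (Finset.le_sup (f := id) ((hVm x).2 ⟨hx, hxV⟩))
  exact hclosed q hq (hz ▸ hztop ▸ le_top)

theorem thick_of (h2 : ∀ a : L, a ≠ ⊥ → a ≠ ⊤ → ∃ c c', IsCompl a c ∧ IsCompl a c' ∧ c ≠ c') :
    Thick L := by
  intro y a b ha hb hab
  obtain ⟨l, hl1, hl2⟩ := IsModularLattice.exists_disjoint_and_sup_eq
    (ha.1.le.trans le_sup_left : y ≤ a ⊔ b)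
  have aux : ∀ a', y ⋖ a' → a' ≤ a ⊔ b → y ⊔ a' ⊓ l = a' ∧ IsAtom (a' ⊓ l) := by
    intro a' h1 h2
    have e1 : y ⊔ a' ⊓ l = a' := by
      rw [inf_comm, ← sup_inf_assoc_of_le _ h1.1.le, hl2]
      exact inf_eq_right.2 h2
    refine ⟨e1, ?_⟩
    have e2 : y ⊓ (a' ⊓ l) = ⊥ := by
      apply le_bot_iff.1
      rw [← hl1.eq_bot]
      exact inf_le_inf_left _ inf_le_right
    rw [← bot_covBy_iff, ← e2]
    apply inf_covBy_of_covBy_sup_left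
    rw [e1]; exact h1
  obtain ⟨a1, a2⟩ := aux a ha le_sup_left
  obtain ⟨b1, b2⟩ := aux b hb le_sup_right
  rcases all_persp h2 _ _ a2 b2 with h | ⟨r, hr, hra, hrb, hrle⟩
  · exfalso; apply hab; rw [← a1, ← b1, h]
  · have hrl : r ≤ l := hrle.trans (sup_le inf_le_right inf_le_right)
    have hry : ¬ r ≤ y := fun h => hr.1 (le_bot_iff.1 (hl1 h hrl))
    refine ⟨r ⊔ y, atom_cov hr hry, ?_, ?_, ?_⟩
    · intro h
      have : r ≤ a ⊓ l := le_inf (h ▸ le_sup_left) hrl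
      exact not_le_of_atoms hr a2 hra this
    · intro h
      have : r ≤ b ⊓ l := le_inf (h ▸ le_sup_left) hrl
      exact not_le_of_atoms hr b2 hrb this
    · refine sup_le (hrle.trans (sup_le_sup inf_le_left inf_le_left)) (ha.1.le.trans le_sup_left)

theorem decomp {a b : L} (hab : IsCompl a b) (huniq : ∀ c, IsCompl a c → c = b) (x : L) :
    x ⊓ a ⊔ x ⊓ b = x := by
  obtain ⟨y, hy1, hy2⟩ := IsModularLattice.exists_disjoint_and_sup_eq (inf_le_left : x ⊓ a ≤ x)
  have hyx : y ≤ x := hy2 ▸ le_sup_right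
  have hdis : Disjoint y a := by
    rw [disjoint_iff_inf_le]
    have : y ⊓ a ≤ x ⊓ a ⊓ y := le_inf (inf_le_inf_right _ hyx) inf_le_left
    exact this.trans hy1.eq_bot.le
  obtain ⟨c, hyc, hc⟩ := hdis.exists_isCompl
  have hcb : c = b := huniq c hc.symm
  apply le_antisymm (sup_le inf_le_left inf_le_left)
  conv_lhs => rw [← hy2]
  exact sup_le_sup_left (le_inf hyx (hyc.trans hcb.le)) _

/-- product decomposition -/
noncomputable def decompIso {a b : L} (hab : IsCompl a b) (huniq : ∀ c, IsCompl a c → c = b) :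
    L ≃o Set.Iic a × Set.Iic b where
  toFun x := (⟨x ⊓ a, inf_le_right⟩, ⟨x ⊓ b, inf_le_right⟩)
  invFun p := p.1.1 ⊔ p.2.1
  left_inv x := decomp hab huniq x
  right_inv := by
    rintro ⟨⟨p, hp⟩, ⟨q, hq⟩⟩
    have hp' : p ≤ a := hp
    have hq' : q ≤ b := hq
    ext
    · change (p ⊔ q) ⊓ a = p
      rw [sup_inf_assoc_of_le _ hp']
      have : q ⊓ a = ⊥ := le_bot_iff.1 (by
        rw [← hab.symm.inf_eq_bot]; exact inf_le_inf_right _ hq')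
      rw [this, sup_bot_eq]
    · change (p ⊔ q) ⊓ b = q
      rw [sup_comm, sup_inf_assoc_of_le _ hq']
      have : p ⊓ b = ⊥ := le_bot_iff.1 (by
        rw [← hab.inf_eq_bot]; exact inf_le_inf_right _ hp')
      rw [this, sup_bot_eq]
  map_rel_iff' := by
    intro x y
    change (_ ∧ _) ↔ _
    constructor
    · rintro ⟨h1, h2⟩
      rw [← decomp hab huniq x, ← decomp hab huniq y]
      exact sup_le_sup h1 h2
    · intro h
      exact ⟨inf_le_inf_right a h, inf_le_inf_right b h⟩

end

theorem Zl_le_of_iso {L L' : Type*} [Lattice L] [Lattice L'] [Finite L] (f : L ≃o L') :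
    Zl L' ≤ Zl L := by
  apply Nat.card_le_card_of_injective
    (fun H : {H : L' // ∀ K₁ K₂ : L', H ⊔ (K₁ ⊓ K₂) = (H ⊔ K₁) ⊓ (H ⊔ K₂)} =>
      (⟨f.symm H.1, fun K₁ K₂ => by
        apply f.injective
        simpa using H.2 (f K₁) (f K₂)⟩ :
        {H : L // ∀ K₁ K₂ : L, H ⊔ (K₁ ⊓ K₂) = (H ⊔ K₁) ⊓ (H ⊔ K₂)}))
  intro a b h
  simpa [Subtype.ext_iff] using h

theorem Zl_prod {L L' : Type*} [Lattice L] [Lattice L'] [Finite L] [Finite L'] :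
    Zl L * Zl L' ≤ Zl (L × L') := by
  unfold Zl
  rw [← Nat.card_prod]
  apply Nat.card_le_card_of_injective
    (fun p : {H : L // ∀ K₁ K₂ : L, H ⊔ (K₁ ⊓ K₂) = (H ⊔ K₁) ⊓ (H ⊔ K₂)} ×
      {H : L' // ∀ K₁ K₂ : L', H ⊔ (K₁ ⊓ K₂) = (H ⊔ K₁) ⊓ (H ⊔ K₂)} =>
      (⟨(p.1.1, p.2.1), fun K₁ K₂ => by
        ext
        · exact p.1.2 _ _
        · exact p.2.2 _ _⟩ :
        {H : L × L' // ∀ K₁ K₂ : L × L', H ⊔ (K₁ ⊓ K₂) = (H ⊔ K₁) ⊓ (H ⊔ K₂)}))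
  rintro ⟨⟨a, _⟩, ⟨b, _⟩⟩ ⟨⟨c, _⟩, ⟨d, _⟩⟩ h
  simpa [Subtype.ext_iff] using h

theorem Zl_ge_two {L : Type*} [Lattice L] [BoundedOrder L] [Finite L] [Nontrivial L] :
    2 ≤ Zl L := by
  unfold Zl
  have : Nontrivial {H : L // ∀ K₁ K₂ : L, H ⊔ (K₁ ⊓ K₂) = (H ⊔ K₁) ⊓ (H ⊔ K₂)} :=
    ⟨⟨⟨⊥, by simp⟩, ⟨⊤, by simp⟩, by simp⟩⟩
  exact Finite.one_lt_card

theorem Zl_ge_one {L : Type*} [Lattice L] [BoundedOrder L] [Finite L] :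
    1 ≤ Zl L := by
  unfold Zl
  have : Nonempty {H : L // ∀ K₁ K₂ : L, H ⊔ (K₁ ⊓ K₂) = (H ⊔ K₁) ⊓ (H ⊔ K₂)} :=
    ⟨⟨⊥, by simp⟩⟩
  exact Nat.card_pos

theorem mu_iso {P Q : Type*} [PartialOrder P] [PartialOrder Q] [Fintype P] [Fintype Q]
    (f : P ≃o Q) (x y : P) (h : x ≤ y) : mu (f x) (f y) = mu x y :=
  mu_embed f (fun _ _ => f.le_iff_le) x (fun _ z _ _ => ⟨f.symm z, by simp⟩) y h

theorem main_bound (n : ℕ) : ∀ (L : Type u) [Lattice L] [BoundedOrder L] [Fintype L]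
    [IsModularLattice L] [ComplementedLattice L], Fintype.card L = n →
    ∑ x : L, |mu x ⊤| ≤ (Zl L : ℝ) ^ 3 * |mu (⊥ : L) ⊤| := by
  induction n using Nat.strong_induction_on with
  | _ n ih =>
    intro L _ _ _ _ _ hn
    by_cases h2 : ∀ a : L, a ≠ ⊥ → a ≠ ⊤ → ∃ c c', IsCompl a c ∧ IsCompl a c' ∧ c ≠ c'
    · rcases subsingleton_or_nontrivial L with hs | hs
      · have hz : (1 : ℝ) ≤ Zl L := by exact_mod_cast Zl_ge_one
        have : ∑ x : L, |mu x ⊤| = 1 := by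
          rw [Fintype.sum_subsingleton _ (⊤ : L), mu_self]; simp
        rw [this, Subsingleton.elim (⊥ : L) ⊤, mu_self, abs_one, mul_one]
        exact one_le_pow₀ hz
      · refine (thick_bound_one (thick_of h2)).trans
          (mul_le_mul_of_nonneg_right ?_ (abs_nonneg _))
        have hz : (2 : ℝ) ≤ Zl L := by exact_mod_cast Zl_ge_two
        calc (8 : ℝ) = 2 ^ 3 := by norm_num
          _ ≤ _ := pow_le_pow_left₀ (by norm_num) hz 3
    · push Not at h2
      obtain ⟨a, ha0, ha1, hu⟩ := h2
      obtain ⟨b, hab⟩ := exists_isCompl a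
      have huniq : ∀ c, IsCompl a c → c = b := fun c hc => hu c b hc hab
      have hb1 : b ≠ ⊤ := by
        rintro rfl
        exact ha0 (by simpa using hab.inf_eq_bot)
      let f := decompIso hab huniq
      have lt_card : ∀ c : L, c ≠ ⊤ → Fintype.card (Set.Iic c) < n := by
        intro c hc
        rw [← hn]
        refine Fintype.card_subtype_lt (x := ⊤) ?_
        intro h
        exact hc (top_le_iff.1 h)
      have i1 := ih _ (lt_card a ha1) (Set.Iic a) rfl
      have i2 := ih _ (lt_card b hb1) (Set.Iic b) rfl
      have hZ : (Zl (Set.Iic a) : ℝ) * Zl (Set.Iic b) ≤ Zl L := by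
        exact_mod_cast Zl_prod.trans (Zl_le_of_iso f)
      have hmu : ∀ x y : L, x ≤ y →
          mu x y = mu (f x).1 (f y).1 * mu (f x).2 (f y).2 := by
        intro x y hxy
        rw [← mu_iso f x y hxy, mu_prod _ _ (f.le_iff_le.2 hxy)]
      have hsum : ∑ x : L, |mu x ⊤| =
          (∑ x : Set.Iic a, |mu x ⊤|) * (∑ x : Set.Iic b, |mu x ⊤|) := by
        rw [Finset.sum_mul_sum, ← Finset.sum_product', Finset.univ_product_univ]
        refine Fintype.sum_equiv f.toEquiv _ _ ?_
        intro x
        rw [hmu x ⊤ le_top, abs_mul, f.map_top]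
        rfl
      rw [hsum, hmu ⊥ ⊤ bot_le, abs_mul, f.map_top, f.map_bot]
      have p1 : (0:ℝ) ≤ ∑ x : Set.Iic b, |mu x ⊤| := Finset.sum_nonneg (fun _ _ => abs_nonneg _)
      have p2 : (0 : ℝ) ≤ (Zl (Set.Iic a) : ℝ) ^ 3 * |mu (⊥ : Set.Iic a) ⊤| := by positivity
      calc _ ≤ _ := mul_le_mul i1 i2 p1 p2
        _ = ((Zl (Set.Iic a) : ℝ) * Zl (Set.Iic b)) ^ 3 *
            (|mu (⊥ : Set.Iic a) ⊤| * |mu (⊥ : Set.Iic b) ⊤|) := by ring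
        _ ≤ _ := mul_le_mul_of_nonneg_right (pow_le_pow_left₀ (by positivity) hZ 3) (by positivity)

end MomentAux

namespace MomentAux

/-- number of distributive elements of `[s, ⊤]` -/
noncomputable def Zi {L : Type*} [Lattice L] (s : L) : ℕ :=
  Nat.card {H : L // s ≤ H ∧ ∀ K₁ K₂ : L, s ≤ K₁ → s ≤ K₂ →
    H ⊔ (K₁ ⊓ K₂) = (H ⊔ K₁) ⊓ (H ⊔ K₂)}

section
variable {L : Type u} [Lattice L] [OrderTop L] [Fintype L] [IsModularLattice L]

theorem Zi_ge_one (s : L) : 1 ≤ Zi s := by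
  rw [Zi, Nat.one_le_iff_ne_zero]
  have : Nonempty {H : L // s ≤ H ∧ ∀ K₁ K₂ : L, s ≤ K₁ → s ≤ K₂ →
      H ⊔ (K₁ ⊓ K₂) = (H ⊔ K₁) ⊓ (H ⊔ K₂)} := ⟨⟨⊤, le_top, by simp⟩⟩
  exact Nat.card_pos.ne'

theorem interval_bound (s : L) (hs : Ss s ⊤) :
    ∑ a with s ≤ a, |mu a ⊤| ≤ (Zi s : ℝ) ^ 3 * |mu s ⊤| := by
  let B : BoundedOrder (Set.Ici s) :=
    { top := ⟨⊤, le_top⟩, le_top := fun x => (le_top : x.1 ≤ ⊤)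
      bot := ⟨s, le_rfl⟩, bot_le := fun x => x.2 }
  have hm : IsModularLattice (Set.Ici s) := ⟨by
    intro x y z h
    exact IsModularLattice.sup_inf_le_assoc_of_le (α := L) y.1 (h : x.1 ≤ z.1)⟩
  have hc : ComplementedLattice (Set.Ici s) := ⟨by
    intro x
    obtain ⟨w, h1, h2⟩ := (Ss_iff.1 hs) x.1 x.2 le_top
    have hw : s ≤ w := h2 ▸ inf_le_right
    refine ⟨⟨w, hw⟩, ?_⟩
    rw [isCompl_iff, disjoint_iff, codisjoint_iff]
    exact ⟨Subtype.ext h2, Subtype.ext h1⟩⟩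
  have key := main_bound _ (Set.Ici s) rfl
  have hmu : ∀ x : Set.Ici s, mu x ⊤ = mu x.1 ⊤ := by
    intro x
    exact (mu_embed (P := Set.Ici s) (Q := L) (fun z => z.1) (fun _ _ => Iff.rfl) x
      (fun y z h1 h2 => ⟨⟨z, le_trans x.2 h1⟩, rfl⟩) ⊤ le_top).symm
  have hZ : Zl (Set.Ici s) = Zi s := by
    refine Nat.card_congr ⟨fun H => ⟨H.1.1, H.1.2, fun K₁ K₂ h1 h2 => ?_⟩,
      fun H => ⟨⟨H.1, H.2.1⟩, fun K₁ K₂ => ?_⟩, fun _ => rfl, fun _ => rfl⟩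
    · exact congrArg Subtype.val (H.2 ⟨K₁, h1⟩ ⟨K₂, h2⟩)
    · exact Subtype.ext (H.2.2 K₁.1 K₂.1 K₁.2 K₂.2)
  simp only [hmu, hZ] at key
  rw [Finset.sum_subtype (p := fun a => s ≤ a) _ (by simp)]
  exact key

/-- the terms occurring in the step -/
noncomputable def tm (i : ℕ) (e s a : L) : ℝ :=
  if IsGreatest {x | x ≤ a ∧ LL i e x} s ∧ LL (i+1) e ⊤ then mu a ⊤ else 0

theorem step_eq (i : ℕ) (e s : L) (h : e ≤ s) :
    ∑ a with s ≤ a, tm i e s a = if LL i e ⊤ then mu s ⊤ else 0 := by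
  obtain ⟨A, hA⟩ := exists_greatest_LL i e
  have e1 : ∑ a with s ≤ a, tm i e s a =
      ∑ a with a ≤ ⊤ ∧ a ⊓ A = s, if LL (i+1) e ⊤ then mu a ⊤ else 0 := by
    rw [Finset.sum_filter, Finset.sum_filter]
    refine Finset.sum_congr rfl fun a _ => ?_
    by_cases hsa : s ≤ a
    · have := greatest_LL_below i hA (h.trans hsa) (b := s)
      simp [tm, this, hsa]
      by_cases h1 : a ⊓ A = s <;> simp [h1]
    · have : a ⊓ A ≠ s := fun hh => hsa (hh ▸ inf_le_left)
      simp [hsa, this]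
  rw [e1]
  by_cases hT : A = ⊤
  · subst hT
    have h1 : LL i e ⊤ := hA.1
    have h2 : ∀ a : L, (a ≤ ⊤ ∧ a ⊓ ⊤ = s) ↔ a = s := by simp
    simp only [h1, LL_succ i h1, h2, if_true]
    rw [Finset.sum_filter, Finset.sum_ite_eq' Finset.univ s]
    simp
  · have h1 : ¬ LL i e ⊤ := fun hh => hT (top_le_iff.1 (hA.2 hh))
    rw [if_neg h1]
    by_cases h2 : LL (i+1) e ⊤
    · simp only [if_pos h2]
      by_cases h3 : s ≤ A
      · exact weisner_inf A ⊤ (lt_top_iff_ne_top.2 hT) s h3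
      · refine Finset.sum_eq_zero fun a ha => ?_
        simp only [Finset.mem_filter] at ha
        exact absurd (ha.2.2 ▸ inf_le_right) h3
    · simp [h2]

theorem step_abs (i : ℕ) (e s : L) (h : e ≤ s) :
    ∑ a with s ≤ a, |tm i e s a| ≤ (Zi s : ℝ) ^ 3 * |mu s ⊤| := by
  obtain ⟨A, hA⟩ := exists_greatest_LL i e
  by_cases h0 : ∀ a, s ≤ a → tm i e s a = 0
  · rw [Finset.sum_eq_zero]
    · positivity
    · intro a ha
      simp only [Finset.mem_filter] at ha
      simp [h0 a ha.2]
  · push Not at h0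
    obtain ⟨a, hsa, ha⟩ := h0
    have hcond : IsGreatest {x | x ≤ a ∧ LL i e x} s ∧ LL (i+1) e ⊤ := by
      by_contra hh
      exact ha (if_neg hh)
    have hm : mu a ⊤ ≠ 0 := by
      rw [tm, if_pos hcond] at ha; exact ha
    have h1 := Ss_of_mu_ne_zero le_top hm
    have h2 := Ss_of_greatest i hA hcond.2
    have h3 := (greatest_LL_below i hA (h.trans hsa)).1 hcond.1
    have h4 := Ss_meet h1 h2 le_top le_top
    rw [h3] at h4
    refine le_trans (Finset.sum_le_sum fun a _ => ?_) (interval_bound s h4)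
    rw [tm]
    split_ifs <;> simp

theorem LL_chain {k : ℕ} (c : Fin (k+1) → L) (h0 : ∀ x, c 0 ≤ x)
    (hk : c (Fin.last k) = ⊤) (hs : ∀ i : Fin k, c i.castSucc ≤ c i.succ ∧
      Ss (c i.castSucc) (c i.succ)) (e : L) : LL k e ⊤ := by
  have : ∀ i : ℕ, ∀ hi : i < k + 1, LL i e (c ⟨i, hi⟩ ⊔ e) := by
    intro i
    induction i with
    | zero =>
      intro hi
      exact sup_eq_right.2 (h0 e)
    | succ i ih =>
      intro hi
      have hh := hs ⟨i, by omega⟩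
      refine ⟨_, le_sup_right, sup_le_sup_right hh.1 e, ih (by omega), ?_⟩
      have h5 := hh.2
      have h6 : Ss (c (Fin.succ ⟨i, by omega⟩) ⊓ (c (Fin.castSucc ⟨i, by omega⟩) ⊔ e))
        (c (Fin.succ ⟨i, by omega⟩)) := Ss_sub h5 (le_inf hh.1 le_sup_left) le_rfl
      have h7 := Ss_up h6
      rw [← sup_assoc, sup_eq_left.2 hh.1] at h7
      exact h7
  have h := this k (by omega)
  have h2 : c ⟨k, by omega⟩ = ⊤ := hk
  rw [h2, top_sup_eq] at h
  exact h

end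

section
variable {P Q : Type*} [Lattice P] [Lattice Q] (f : P ↪o Q)

theorem emb_sup (hf : ∀ x z, z ≤ f x → ∃ z', f z' = z) (z w : P) : f (z ⊔ w) = f z ⊔ f w := by
  apply le_antisymm
  · obtain ⟨t, ht⟩ := hf (z ⊔ w) (f z ⊔ f w)
      (sup_le (f.le_iff_le.2 le_sup_left) (f.le_iff_le.2 le_sup_right))
    rw [← ht, f.le_iff_le]
    exact sup_le (f.le_iff_le.1 (ht ▸ le_sup_left)) (f.le_iff_le.1 (ht ▸ le_sup_right))
  · exact sup_le (f.le_iff_le.2 le_sup_left) (f.le_iff_le.2 le_sup_right)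

theorem emb_inf (hf : ∀ x z, z ≤ f x → ∃ z', f z' = z) (z w : P) : f (z ⊓ w) = f z ⊓ f w := by
  apply le_antisymm
  · exact le_inf (f.le_iff_le.2 inf_le_left) (f.le_iff_le.2 inf_le_right)
  · obtain ⟨t, ht⟩ := hf z (f z ⊓ f w) inf_le_left
    rw [← ht, f.le_iff_le]
    exact le_inf (f.le_iff_le.1 (ht ▸ inf_le_left)) (f.le_iff_le.1 (ht ▸ inf_le_right))

theorem Ss_embed (hf : ∀ x z, z ≤ f x → ∃ z', f z' = z) (y x : P) : Ss (f y) (f x) ↔ Ss y x := by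
  rw [Ss_iff, Ss_iff]
  constructor
  · intro h z h1 h2
    obtain ⟨w, hw1, hw2⟩ := h (f z) (f.le_iff_le.2 h1) (f.le_iff_le.2 h2)
    obtain ⟨w, rfl⟩ := hf x w (hw1 ▸ le_sup_right)
    rw [← emb_sup f hf, f.eq_iff_eq] at hw1
    rw [← emb_inf f hf, f.eq_iff_eq] at hw2
    exact ⟨w, hw1, hw2⟩
  · intro h z h1 h2
    obtain ⟨z, rfl⟩ := hf x z h2
    obtain ⟨w, hw1, hw2⟩ := h z (f.le_iff_le.1 h1) (f.le_iff_le.1 h2)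
    exact ⟨f w, by rw [← emb_sup f hf, hw1], by rw [← emb_inf f hf, hw2]⟩

theorem LL_embed (hf : ∀ x z, z ≤ f x → ∃ z', f z' = z) (i : ℕ) (e x : P) : LL i (f e) (f x) ↔ LL i e x := by
  induction i generalizing x with
  | zero => simp [LL]
  | succ i ih =>
    constructor
    · rintro ⟨y, h1, h2, h3, h4⟩
      obtain ⟨y, rfl⟩ := hf x y h2
      exact ⟨y, f.le_iff_le.1 h1, f.le_iff_le.1 h2, (ih y).1 h3, (Ss_embed f hf _ _).1 h4⟩
    · rintro ⟨y, h1, h2, h3, h4⟩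
      exact ⟨f y, f.le_iff_le.2 h1, f.le_iff_le.2 h2, (ih y).2 h3, (Ss_embed f hf _ _).2 h4⟩

theorem greatest_embed [OrderTop P] (hf : ∀ x z, z ≤ f x → ∃ z', f z' = z) 
    (i : ℕ) (e s : P) :
    IsGreatest {x | x ≤ f ⊤ ∧ LL i (f e) x} (f s) ↔ IsGreatest {x | LL i e x} s := by
  constructor
  · rintro ⟨h1, h2⟩
    exact ⟨(LL_embed f hf i e s).1 h1.2, fun x hx => f.le_iff_le.1
      (h2 ⟨f.le_iff_le.2 le_top, (LL_embed f hf i e x).2 hx⟩)⟩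
  · rintro ⟨h1, h2⟩
    refine ⟨⟨f.le_iff_le.2 le_top, (LL_embed f hf i e s).2 h1⟩, fun x hx => ?_⟩
    obtain ⟨x, rfl⟩ := hf ⊤ x hx.1
    exact f.le_iff_le.2 (h2 ((LL_embed f hf i e x).1 hx.2))

end
end MomentAux

namespace MomentAux
open MomentCat

section cat
variable {C : Type u} [SmallCategory C] [hCF : Fact (IsDiamond C)]

theorem isLUB_qSup {G : C} (a b : Quotients G) : IsLUB {a, b} (qSup a b) := by
  have h := hCF.out.lub G a b
  rw [qSup, dif_pos h]
  exact h.choose_spec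

theorem isGLB_qInf {G : C} (a b : Quotients G) : IsGLB {a, b} (qInf a b) := by
  have h := hCF.out.glb G a b
  rw [qInf, dif_pos h]
  exact h.choose_spec

noncomputable instance instLat (G : C) : Lattice (Quotients G) :=
  { (inferInstance : PartialOrder (Quotients G)) with
    sup := qSup
    inf := qInf
    le_sup_left := fun a b => (isLUB_qSup a b).1 (by simp)
    le_sup_right := fun a b => (isLUB_qSup a b).1 (by simp)
    sup_le := fun a b c h1 h2 => (isLUB_qSup a b).2 (by
      intro x hx
      simp only [Set.mem_insert_iff, Set.mem_singleton_iff] at hx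
      rcases hx with rfl | rfl <;> assumption)
    inf_le_left := fun a b => (isGLB_qInf a b).1 (by simp)
    inf_le_right := fun a b => (isGLB_qInf a b).1 (by simp)
    le_inf := fun a b c h1 h2 => (isGLB_qInf b c).2 (by
      intro x hx
      simp only [Set.mem_insert_iff, Set.mem_singleton_iff] at hx
      rcases hx with rfl | rfl <;> assumption) }

theorem qSup_eq {G : C} (a b : Quotients G) : qSup a b = a ⊔ b := rfl
theorem qInf_eq {G : C} (a b : Quotients G) : qInf a b = a ⊓ b := rfl

instance instMod (G : C) : IsModularLattice (Quotients G) := ⟨by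
  intro x y z h
  have := hCF.out.modular G x z y h
  simp only [qSup_eq, qInf_eq] at this
  exact this.ge⟩

noncomputable instance instFt (G : C) : Fintype (Quotients G) :=
  @Fintype.ofFinite _ (hCF.out.quotFinite G)

instance instAut (G : C) : Finite (Aut G) := hCF.out.autFinite G

theorem mob_eq (mob : ∀ G : C, Quotients G → Quotients G → ℝ) (hmob : IsMobiusFamily mob)
    (G : C) (x y : Quotients G) (h : x ≤ y) : mob G x y = mu x y := by
  refine mu_unique (fun y => mob G x y) x ((hmob G).1 x) (fun y hy => ?_) y h
  have := (hmob G).2 x y hy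
  rw [← this, finsum_mem_eq_finite_toFinset_sum _ (Set.toFinite _)]
  refine Finset.sum_congr ?_ fun _ _ => rfl
  ext z
  simp

theorem Zfn_eq {G F : C} (π : G ⟶ F) (h : Epi π) : Zfn π h = Zi (quotOf π h) := rfl

theorem LL_cx {G : C} {k : ℕ} (h : complexityLE G k) (e : Quotients G) : LL k e ⊤ := by
  obtain ⟨c, h1, h2, h3⟩ := h
  have hex : ∃ b : Quotients G, ∀ x, b ≤ x := by
    obtain ⟨b, hb⟩ := Set.Finite.exists_minimal (Set.toFinite (Set.univ : Set (Quotients G)))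
      ⟨⊤, trivial⟩
    exact ⟨b, fun x => (hb.2 (y := b ⊓ x) trivial inf_le_left).trans inf_le_right⟩
  refine LL_chain c ?_ h2 (fun i => ⟨(h3 i).1, ?_⟩) e
  · rw [h1, qBot, dif_pos hex]
    exact hex.choose_spec
  · rw [Ss_iff]
    intro z hz1 hz2
    obtain ⟨w, _, _, hw1, hw2⟩ := (h3 i).2 z hz1 hz2
    exact ⟨w, hw1, hw2⟩

/-! quotient maps -/

/-- composition of epis -/
def Epis.comp {G H F : C} (π : Epis G H) (ρ : Epis H F) : Epis G F :=
  ⟨π.1 ≫ ρ.1, epiComp π.2 ρ.2⟩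

/-- class of epi -/
noncomputable def qo {G F : C} (π : Epis G F) : Quotients G := quotOf π.1 π.2

theorem Epis.comp_assoc {G H F E : C} (π : Epis G H) (ρ : Epis H F) (τ : Epis F E) :
    Epis.comp (Epis.comp π ρ) τ = Epis.comp π (Epis.comp ρ τ) :=
  Subtype.ext (Category.assoc _ _ _)

theorem qo_le_iff {G H F : C} (σ : Epis G F) (π : Epis G H) :
    qo σ ≤ qo π ↔ ∃ ρ : Epis H F, Epis.comp π ρ = σ := by
  have := σ.2
  have := π.2
  constructor
  · intro h
    have h' : Subobject.mk σ.1.op ≤ Subobject.mk π.1.op := h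
    let r := Subobject.ofMkLEMk _ _ h'
    have hr : r ≫ π.1.op = σ.1.op := Subobject.ofMkLEMk_comp h'
    have hr' : π.1 ≫ r.unop = σ.1 := by
      have := congrArg Quiver.Hom.unop hr
      simpa using this
    have : Epi r.unop := epi_of_epi_fac hr'
    exact ⟨⟨r.unop, this⟩, Subtype.ext hr'⟩
  · rintro ⟨ρ, rfl⟩
    have := ρ.2
    refine Subobject.mk_le_mk_of_comm ρ.1.op ?_
    simp [Epis.comp]

theorem qo_comp_le {G H F : C} (π : Epis G H) (ρ : Epis H F) : qo (Epis.comp π ρ) ≤ qo π :=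
  (qo_le_iff _ _).2 ⟨ρ, rfl⟩


/-- identity epi -/
def idE (G : C) : Epis G G := ⟨𝟙 G, inferInstance⟩

theorem qo_id (G : C) : qo (idE G) = ⊤ := by
  rw [qo, quotOf, ← Subobject.isIso_iff_mk_eq_top]
  simp only [idE]
  infer_instance

theorem comp_id {G H : C} (π : Epis G H) : Epis.comp π (idE H) = π :=
  Subtype.ext (Category.comp_id _)

theorem id_comp {G H : C} (π : Epis G H) : Epis.comp (idE G) π = π :=
  Subtype.ext (Category.id_comp _)

/-- the canonical epi for a quotient -/
noncomputable def arr {G : C} (a : Quotients G) : Epis G (qObj a) :=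
  ⟨a.arrow.unop, by
    have : Mono (Subobject.arrow a) := inferInstance
    exact CategoryTheory.unop_epi_of_mono a.arrow⟩

theorem qo_arr {G : C} (a : Quotients G) : qo (arr a) = a := by
  rw [qo, quotOf]
  simp only [arr, Quiver.Hom.op_unop]
  exact Subobject.mk_arrow a

theorem comp_cancel {G H F : C} (π : Epis G H) {ρ ρ' : Epis H F}
    (h : Epis.comp π ρ = Epis.comp π ρ') : ρ = ρ' := by
  have := π.2
  have h2 := congrArg Subtype.val h
  simp only [Epis.comp] at h2
  exact Subtype.ext ((cancel_epi _).1 h2)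

/-- pullback of quotients along an epi -/
noncomputable def jf {G H : C} (π : Epis G H) (x : Quotients H) : Quotients G :=
  haveI := π.2
  (Subobject.map π.1.op).obj x

theorem jf_qo {G H F : C} (π : Epis G H) (ρ : Epis H F) : jf π (qo ρ) = qo (Epis.comp π ρ) := by
  have := π.2
  have := ρ.2
  have := epiComp π.2 ρ.2
  simp only [jf, qo, quotOf, Subobject.map_mk, Epis.comp]
  rfl

theorem jf_le {G H : C} (π : Epis G H) (x y : Quotients H) : jf π x ≤ jf π y ↔ x ≤ y := by
  rw [← qo_arr x, ← qo_arr y, jf_qo, jf_qo, qo_le_iff, qo_le_iff]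
  refine exists_congr fun τ => ?_
  rw [Epis.comp_assoc]
  exact ⟨comp_cancel π, fun h => by rw [h]⟩

/-- pullback as an order embedding -/
noncomputable def jj {G H : C} (π : Epis G H) : Quotients H ↪o Quotients G :=
  OrderEmbedding.ofMapLEIff (jf π) (jf_le π)

theorem jj_qo {G H F : C} (π : Epis G H) (ρ : Epis H F) : jj π (qo ρ) = qo (Epis.comp π ρ) :=
  jf_qo π ρ

theorem jj_top {G H : C} (π : Epis G H) : jj π ⊤ = qo π := by
  rw [← qo_id, jj_qo, comp_id]

theorem jj_range {G H : C} (π : Epis G H) (x : Quotients H) (z : Quotients G) (h : z ≤ jj π x) :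
    ∃ z', jj π z' = z := by
  have h1 : z ≤ qo π := h.trans (by rw [← jj_top]; exact (jj π).le_iff_le.2 le_top)
  rw [← qo_arr z, qo_le_iff] at h1
  obtain ⟨ρ, hρ⟩ := h1
  exact ⟨qo ρ, by rw [jj_qo, hρ, qo_arr]⟩

/-- composing with an isomorphism -/
def isoE {H F : C} (f : H ≅ F) : Epis H F := ⟨f.hom, inferInstance⟩

theorem qo_isoE {G H F : C} (π : Epis G H) (f : H ≅ F) : qo (Epis.comp π (isoE f)) = qo π := by
  refine le_antisymm (qo_comp_le _ _) ?_
  rw [qo_le_iff]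
  refine ⟨isoE f.symm, Subtype.ext ?_⟩
  simp [Epis.comp, isoE]

theorem qo_eq_iso {G H F : C} (π : Epis G H) (π' : Epis G F) (h : qo π = qo π') :
    ∃ f : H ≅ F, Epis.comp π (isoE f) = π' := by
  obtain ⟨ρ, hρ⟩ := (qo_le_iff π' π).1 h.ge
  obtain ⟨ρ', hρ'⟩ := (qo_le_iff π π').1 h.le
  refine ⟨⟨ρ.1, ρ'.1, ?_, ?_⟩, hρ⟩
  · have : Epis.comp π (Epis.comp ρ ρ') = Epis.comp π (idE _) := by
      rw [← Epis.comp_assoc, hρ, hρ', comp_id]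
    exact congrArg Subtype.val (comp_cancel _ this)
  · have : Epis.comp π' (Epis.comp ρ' ρ) = Epis.comp π' (idE _) := by
      rw [← Epis.comp_assoc, hρ', hρ, comp_id]
    exact congrArg Subtype.val (comp_cancel _ this)

theorem isoE_inj {H F : C} {f g : H ≅ F} (h : isoE f = isoE g) : f = g :=
  Iso.ext (congrArg Subtype.val h)

/-- the chosen isomorphism with the representative -/
noncomputable def outIso (G : C) : G ≅ (cls G).out :=
  (Classical.choice (Quotient.exact (Quotient.out_eq (cls G)))).symm

theorem cls_eq {G H : C} (f : G ≅ H) : cls G = cls H := Quotient.sound ⟨f⟩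

theorem cls_out (X : IsoCls C) : cls X.out = X := Quotient.out_eq X

instance finEpis (G H : C) : Finite (Epis G H) := by
  by_cases hne : Nonempty (Epis G H)
  · let f : Epis G H → Quotients G := qo
    have : ∀ a : Quotients G, (f ⁻¹' {a}).Finite := by
      intro a
      by_cases ha : ∃ π, f π = a
      · obtain ⟨π, hπ⟩ := ha
        refine (Set.finite_range (fun g : Aut H => Epis.comp π (isoE g))).subset ?_
        intro π' hπ'
        obtain ⟨g, hg⟩ := qo_eq_iso π π' (by rw [show qo π = a from hπ]; exact hπ'.symm)
        exact ⟨g, hg⟩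
      · convert Set.finite_empty
        ext π
        simp only [Set.mem_preimage, Set.mem_singleton_iff, Set.mem_empty_iff_false, iff_false]
        exact fun h => ha ⟨π, h⟩
    have h2 : (Set.univ : Set (Epis G H)).Finite := by
      rw [← Set.preimage_univ (f := f), ← Set.biUnion_preimage_singleton]
      exact (Set.toFinite _).biUnion fun a _ => this a
    exact Set.finite_univ_iff.1 h2
  · rw [not_nonempty_iff] at hne
    infer_instance

variable {W : Set C} 

/-- downward-closed wrapper -/
theorem cls_mem (hW : DownwardClosed W) {G : C} (hG : G ∈ W) : (cls G).out ∈ W :=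
  hW G hG _ (outIso G).hom inferInstance

/-- the representative in `W` of a quotient -/
noncomputable def rp (hW : DownwardClosed W) {G : C} (hG : G ∈ W) (a : Quotients G) : WSub W :=
  ⟨cls (qObj a), cls_mem hW (hW G hG _ (arr a).1 (arr a).2)⟩

/-- its epi -/
noncomputable def rpE (hW : DownwardClosed W) {G : C} (hG : G ∈ W) (a : Quotients G) :
    Epis G (rp hW hG a).1.out :=
  Epis.comp (arr a) (isoE (outIso _))

theorem qo_rpE (hW : DownwardClosed W) {G : C} (hG : G ∈ W) (a : Quotients G) :
    qo (rpE hW hG a) = a := by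
  exact (qo_isoE _ _).trans (qo_arr a)

/-- factorizations of `σ` -/
def Tr (W : Set C) {G F : C} (σ : Epis G F) : Type u :=
  {t : Σ H : WSub W, Epis G H.1.out × Epis H.1.out F // Epis.comp t.2.1 t.2.2 = σ}

theorem Tr.ext' {G F : C} {σ : Epis G F} (t t' : Tr W σ)
    (h : (⟨t.1.1, t.1.2.1⟩ : Σ H : WSub W, Epis G H.1.out) = ⟨t'.1.1, t'.1.2.1⟩) : t = t' := by
  obtain ⟨⟨H, π, ρ⟩, h1⟩ := t
  obtain ⟨⟨H', π', ρ'⟩, h2⟩ := t'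
  simp only [Sigma.mk.injEq] at h
  obtain ⟨rfl, h⟩ := h
  obtain rfl := eq_of_heq h
  obtain rfl := comp_cancel _ (h1.trans h2.symm)
  rfl

/-- the parametrization of factorizations -/
noncomputable def trMap (hW : DownwardClosed W) {G F : C} (hG : G ∈ W) (σ : Epis G F) :
    (Σ a : {a : Quotients G // qo σ ≤ a}, ((rp hW hG a.1).1.out ≅ (rp hW hG a.1).1.out)) →
    Tr W σ := fun q =>
  have h : qo σ ≤ qo (Epis.comp (rpE hW hG q.1.1) (isoE q.2)) := by
    rw [qo_isoE, qo_rpE]; exact q.1.2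
  ⟨⟨rp hW hG q.1.1, Epis.comp (rpE hW hG q.1.1) (isoE q.2), ((qo_le_iff _ _).1 h).choose⟩,
    ((qo_le_iff _ _).1 h).choose_spec⟩

theorem trMap_qo (hW : DownwardClosed W) {G F : C} (hG : G ∈ W) (σ : Epis G F) (q) :
    qo (trMap hW hG σ q).1.2.1 = q.1.1 := by
  simp only [trMap, qo_isoE, qo_rpE]

theorem trMap_surj_aux {G : C} {R H : WSub W} (hR : R = H) (π₀ : Epis G R.1.out)
    (π : Epis G H.1.out) (h : qo π₀ = qo π) : ∃ g : R.1.out ≅ R.1.out,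
      (⟨R, Epis.comp π₀ (isoE g)⟩ : Σ H : WSub W, Epis G H.1.out) = ⟨H, π⟩ := by
  subst hR
  obtain ⟨f, hf⟩ := qo_eq_iso _ _ h
  exact ⟨f, by rw [hf]⟩

theorem trMap_bij (hW : DownwardClosed W) {G F : C} (hG : G ∈ W) (σ : Epis G F) :
    Function.Bijective (trMap hW hG σ) := by
  constructor
  · rintro ⟨⟨a, ha⟩, g⟩ ⟨⟨b, hb⟩, g'⟩ h
    have hab : a = b := by
      have := congrArg (fun t : Tr W σ => qo t.1.2.1) h
      simpa only [trMap_qo] using this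
    subst hab
    have h1 := congrArg Subtype.val h
    simp only [trMap, Sigma.mk.injEq, heq_eq_eq, true_and, Prod.mk.injEq] at h1
    have := isoE_inj (comp_cancel _ h1.1)
    subst this
    rfl
  · rintro ⟨⟨H, π, ρ⟩, h⟩
    have ha : qo σ ≤ qo π := (qo_le_iff _ _).2 ⟨ρ, h⟩
    obtain ⟨f, hf⟩ := qo_eq_iso (rpE hW hG (qo π)) π (qo_rpE hW hG _)
    have hH : rp hW hG (qo π) = H := by
      apply Subtype.ext
      have := cls_eq f
      rwa [cls_out, cls_out] at this
    obtain ⟨g, hg⟩ := trMap_surj_aux hH (rpE hW hG (qo π)) π (qo_rpE hW hG _)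
    exact ⟨⟨⟨qo π, ha⟩, g⟩, Tr.ext' _ _ hg⟩

/-- the parametrization of factorizations, as an equivalence -/
noncomputable def trEquiv (hW : DownwardClosed W) {G F : C} (hG : G ∈ W) (σ : Epis G F) :
    (Σ a : {a : Quotients G // qo σ ≤ a}, ((rp hW hG a.1).1.out ≅ (rp hW hG a.1).1.out)) ≃
    Tr W σ := Equiv.ofBijective _ (trMap_bij hW hG σ)

theorem trFin (hW : DownwardClosed W) {G F : C} (hG : G ∈ W) (σ : Epis G F) :
    Finite (Tr W σ) := by
  have : ∀ X : C, Finite (X ≅ X) := fun X => instAut X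
  exact Finite.of_equiv _ (trEquiv hW hG σ)

/-- size of automorphism group -/
noncomputable def nA (X : C) : ℕ := Nat.card (Aut X)

theorem nA_pos (X : C) : 0 < nA X := by
  have : Nonempty (Aut X) := ⟨1⟩
  exact Nat.card_pos

/-- Lemma K. -/
theorem lemK (hW : DownwardClosed W) {G F : C} (hG : G ∈ W) (σ : Epis G F)
    (g : Quotients G → ℝ) :
    ∑' t : Tr W σ, g (qo t.1.2.1) / (nA t.1.1.1.out : ℝ) = ∑ a with qo σ ≤ a, g a := by
  have : ∀ X : C, Finite (X ≅ X) := fun X => instAut X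
  have := trFin hW hG σ
  have : ∀ X : C, Fintype (X ≅ X) := fun X => Fintype.ofFinite _
  have : Fintype (Tr W σ) := Fintype.ofFinite _
  rw [← (trEquiv hW hG σ).tsum_eq, tsum_fintype, Fintype.sum_sigma,
    Finset.sum_subtype (p := fun a => qo σ ≤ a) _ (by simp)]
  refine Finset.sum_congr rfl fun a _ => ?_
  have h1 : ∀ f : (rp hW hG a.1).1.out ≅ (rp hW hG a.1).1.out,
    g (qo (trEquiv hW hG σ ⟨a, f⟩).1.2.1) / (nA (trEquiv hW hG σ ⟨a, f⟩).1.1.1.out : ℝ)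
      = g a.1 / (nA (rp hW hG a.1).1.out : ℝ) := by
    intro f
    have : qo (trEquiv hW hG σ ⟨a, f⟩).1.2.1 = a.1 := trMap_qo hW hG σ ⟨a, f⟩
    rw [this]
    rfl
  rw [Finset.sum_congr rfl fun f _ => h1 f, Finset.sum_const, nsmul_eq_mul]
  have h2 : (Finset.univ : Finset ((rp hW hG a.1).1.out ≅ (rp hW hG a.1).1.out)).card
      = nA (rp hW hG a.1).1.out := by
    rw [Finset.card_univ, ← Nat.card_eq_fintype_card]; rfl
  rw [h2]
  have := nA_pos (rp hW hG a.1).1.out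
  field_simp

end cat
end MomentAux

namespace MomentAux
open MomentCat

section an
variable {C : Type u} [SmallCategory C] [hCF : Fact (IsDiamond C)] {W : Set C}

/-- members of `W` with an epi to `F` -/
abbrev Sg (W : Set C) (F : C) := Σ X : WSub W, Epis X.1.out F

theorem pair_aux {F : C} (G H : WSub W) (π : Epis G.1.out H.1.out) (ρ : Epis H.1.out F)
    (σ : Epis G.1.out F) (h : Epis.comp π ρ = σ) :
    (⟨⟨G, Epis.comp π ρ⟩, ⟨⟨H, π, ρ⟩, rfl⟩⟩ : Σ g : Sg W F, Tr W g.2) =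
      ⟨⟨G, σ⟩, ⟨⟨H, π, ρ⟩, h⟩⟩ := by
  subst h
  rfl

/-- reindexing of composable pairs -/
noncomputable def pairEquiv (W : Set C) (F : C) :
    (Σ h : Sg W F, Sg W h.1.1.out) ≃ (Σ g : Sg W F, Tr W g.2) where
  toFun q := ⟨⟨q.2.1, Epis.comp q.2.2 q.1.2⟩, ⟨⟨q.1.1, q.2.2, q.1.2⟩, rfl⟩⟩
  invFun q := ⟨⟨q.2.1.1, q.2.1.2.2⟩, ⟨q.1.1, q.2.1.2.1⟩⟩
  left_inv q := rfl
  right_inv := by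
    rintro ⟨⟨G, σ⟩, ⟨⟨H, π, ρ⟩, h⟩⟩
    exact pair_aux G H π ρ σ h

theorem fub (hW : DownwardClosed W) (F : C) (c : ∀ g : Sg W F, Quotients g.1.1.out → ℝ)
    (hs : Summable fun g : Sg W F => ∑ a with qo g.2 ≤ a, |c g a|) :
    HasSum (fun q : (Σ h : Sg W F, Sg W h.1.1.out) =>
      c ⟨q.2.1, Epis.comp q.2.2 q.1.2⟩ (qo q.2.2) / (nA q.1.1.1.out : ℝ))
      (∑' g : Sg W F, ∑ a with qo g.2 ≤ a, c g a) := by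
  let f : (Σ g : Sg W F, Tr W g.2) → ℝ := fun q =>
    c q.1 (qo q.2.1.2.1) / (nA q.2.1.1.1.out : ℝ)
  have hfin : ∀ g : Sg W F, Finite (Tr W g.2) := fun g => trFin hW g.1.2 g.2
  have h1 : Summable f := by
    rw [← summable_abs_iff, summable_sigma_of_nonneg (fun _ => abs_nonneg _)]
    refine ⟨fun g => Summable.of_finite, ?_⟩
    convert hs using 2 with g
    rw [← lemK hW g.1.2 g.2 (fun a => |c g a|)]
    refine tsum_congr fun t => ?_
    simp only [f]
    rw [abs_div, Nat.abs_cast]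
  have h2 : ∑' q, f q = ∑' g : Sg W F, ∑ a with qo g.2 ≤ a, c g a := by
    rw [h1.tsum_sigma' (fun g => Summable.of_finite)]
    refine tsum_congr fun g => ?_
    rw [← lemK hW g.1.2 g.2 (c g)]
  have h3 := h1.hasSum
  rw [h2] at h3
  exact (pairEquiv W F).hasSum_iff.2 h3

variable (M : IsoCls C → ℝ)

/-- summand of `v` -/
noncomputable def vt (W : Set C) (i : ℕ) {E : C} (H : C) (φ : Epis H E) (p : Sg W H) : ℝ :=
  (if LL i (qo (Epis.comp p.2 φ)) ⊤ then mu (qo p.2) ⊤ else 0) * M p.1.1 / (nA p.1.1.out : ℝ)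
    / (nA H : ℝ)

/-- truncated `v` -/
noncomputable def vv (W : Set C) (i : ℕ) {E : C} (H : C) (φ : Epis H E) : ℝ :=
  ∑' p : Sg W H, vt M W i H φ p

/-- well-behaved reformulated -/
def Wb (W : Set C) : Prop := ∀ F : C, F ∈ W → Summable (fun p : Sg W F =>
  ((Zi (qo p.2) : ℝ) ^ 3 * |mu (qo p.2) ⊤|) * (|M p.1.1| / (nA p.1.1.out : ℝ)))

theorem wb_of {mob : ∀ G : C, Quotients G → Quotients G → ℝ} (hmob : IsMobiusFamily mob)
    (h : WellBehavedAt mob M W) : Wb M W := by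
  intro F hF
  refine (h F hF).congr fun p => ?_
  rw [mob_eq mob hmob _ _ _ le_top, Zfn_eq]
  simp only [nA, qo]
  ring

/-- coefficients of the step -/
noncomputable def cc (W : Set C) (i : ℕ) {E F : C} (χ : Epis F E) (g : Sg W F)
    (a : Quotients g.1.1.out) : ℝ :=
  tm i (qo (Epis.comp g.2 χ)) (qo g.2) a * (M g.1.1 / (nA g.1.1.out : ℝ) / (nA F : ℝ))

theorem cc_abs (i : ℕ) {E F : C} (χ : Epis F E) (g : Sg W F) :
    ∑ a with qo g.2 ≤ a, |cc M W i χ g a| ≤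
      ((Zi (qo g.2) : ℝ) ^ 3 * |mu (qo g.2) ⊤|) * (|M g.1.1| / (nA g.1.1.out : ℝ))
        * (1 / (nA F : ℝ)) := by
  simp only [cc, abs_mul]
  rw [← Finset.sum_mul]
  have h1 := step_abs i (qo (Epis.comp g.2 χ)) (qo g.2) (qo_comp_le _ _)
  have h2 : |M g.1.1 / (nA g.1.1.out : ℝ) / (nA F : ℝ)| =
      (|M g.1.1| / (nA g.1.1.out : ℝ)) * (1 / (nA F : ℝ)) := by
    rw [abs_div, abs_div, Nat.abs_cast, Nat.abs_cast]; ring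
  rw [h2, ← mul_assoc]
  gcongr

theorem cc_sum (i : ℕ) {E F : C} (χ : Epis F E) (g : Sg W F) :
    ∑ a with qo g.2 ≤ a, cc M W i χ g a = vt M W i F χ g := by
  simp only [cc]
  rw [← Finset.sum_mul, step_eq i _ _ (qo_comp_le _ _), vt]
  ring

theorem step (hW : DownwardClosed W) (hwb : Wb M W) (i : ℕ) {E F : C} (hF : F ∈ W)
    (χ : Epis F E) :
    HasSum (fun h : Sg W F => (if IsGreatest {x | LL i (qo (Epis.comp h.2 χ)) x} (qo h.2)
      then vv M W (i+1) h.1.1.out (Epis.comp h.2 χ) else 0) / (nA F : ℝ)) (vv M W i F χ) := by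
  have hs : Summable fun g : Sg W F => ∑ a with qo g.2 ≤ a, |cc M W i χ g a| :=
    Summable.of_nonneg_of_le (fun g => Finset.sum_nonneg fun _ _ => abs_nonneg _)
      (cc_abs M i χ) ((hwb F hF).mul_right _)
  have h1 := fub hW F (cc M W i χ) hs
  simp only [cc_sum] at h1
  have h2 := h1.sigma (fun h => (h1.summable.sigma_factor h).hasSum)
  have h2' : HasSum _ (vv M W i F χ) := h2
  refine HasSum.congr_fun h2' fun h => ?_
  have h3 : ∀ b : Sg W h.1.1.out,
      cc M W i χ ⟨b.1, Epis.comp b.2 h.2⟩ (qo b.2) / (nA h.1.1.out : ℝ) =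
      (if IsGreatest {x | LL i (qo (Epis.comp h.2 χ)) x} (qo h.2) then
        vt M W (i+1) h.1.1.out (Epis.comp h.2 χ) b else 0) / (nA F : ℝ) := by
    intro b
    have h4 := greatest_embed (jj b.2) (jj_range b.2) i (qo (Epis.comp h.2 χ)) (qo h.2)
    rw [jj_top, jj_qo, jj_qo, ← Epis.comp_assoc] at h4
    simp only [cc, tm, vt, h4, ← Epis.comp_assoc]
    by_cases h5 : IsGreatest {x | LL i (qo (Epis.comp h.2 χ)) x} (qo h.2)
    · simp only [h5, true_and, if_true]
      ring
    · simp [h5]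
  refine Eq.trans ?_ (tsum_congr h3).symm
  rw [tsum_div_const]
  congr 1
  by_cases h5 : IsGreatest {x | LL i (qo (Epis.comp h.2 χ)) x} (qo h.2)
  · simp only [h5, if_true]; rfl
  · simp [h5]

theorem vv_nonneg (hW : DownwardClosed W) (hwb : Wb M W) {E : C} (k : ℕ)
    (hk : ∀ H : C, H ∈ W → ∀ φ : Epis H E, 0 ≤ vv M W k H φ) (j : ℕ) :
    ∀ i, i + j = k → ∀ H : C, H ∈ W → ∀ φ : Epis H E, 0 ≤ vv M W i H φ := by
  induction j with
  | zero => rintro i rfl; exact hk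
  | succ j ih =>
    intro i hi H hH φ
    refine (step M hW hwb i hH φ).nonneg fun h => ?_
    have := ih (i+1) (by omega) h.1.1.out h.1.2 (Epis.comp h.2 φ)
    split_ifs
    · positivity
    · simp

theorem S_step (hW : DownwardClosed W) (hwb : Wb M W) {E : C} (i : ℕ)
    (hk : ∀ H : C, H ∈ W → ∀ φ : Epis H E, 0 ≤ vv M W (i+1) H φ) :
    ∑' p : Sg W E, ENNReal.ofReal (vv M W i p.1.1.out p.2) =
    ∑' p : Sg W E, ENNReal.ofReal (vv M W (i+1) p.1.1.out p.2) := by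
  let T : (Σ g : Sg W E, Tr W g.2) → ℝ := fun q =>
    (if IsGreatest {x | LL i (qo q.1.2) x} (qo q.2.1.2.1)
      then vv M W (i+1) q.1.1.1.out q.1.2 else 0) / (nA q.2.1.1.1.out : ℝ)
  have hT : ∀ q, 0 ≤ T q := by
    intro q
    have := hk q.1.1.1.out q.1.1.2 q.1.2
    simp only [T]
    split_ifs
    · positivity
    · simp
  have h1 : ∀ p : Sg W E, ENNReal.ofReal (vv M W i p.1.1.out p.2) =
      ∑' h : Sg W p.1.1.out, ENNReal.ofReal (T (pairEquiv W E ⟨p, h⟩)) := by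
    intro p
    have h2 : HasSum (fun h => T (pairEquiv W E ⟨p, h⟩)) _ := step M hW hwb i p.1.2 p.2
    rw [← h2.tsum_eq, ENNReal.ofReal_tsum_of_nonneg (fun h => hT (pairEquiv W E ⟨p, h⟩)) h2.summable]
  rw [tsum_congr h1, ← ENNReal.tsum_sigma (fun p h => ENNReal.ofReal (T (pairEquiv W E ⟨p, h⟩))),
    (pairEquiv W E).tsum_eq (fun q => ENNReal.ofReal (T q)), ENNReal.tsum_sigma']
  refine tsum_congr fun g => ?_
  have := trFin hW g.1.2 g.2
  rw [← ENNReal.ofReal_tsum_of_nonneg (fun t => hT _) Summable.of_finite]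
  congr 1
  have h3 := lemK hW g.1.2 g.2 (fun a => if IsGreatest {x | LL i (qo g.2) x} a
      then vv M W (i+1) g.1.1.out g.2 else 0)
  refine h3.trans ?_
  obtain ⟨A, hA⟩ := exists_greatest_LL i (qo g.2)
  rw [Finset.sum_eq_single A]
  · simp [hA]
  · intro b _ hb
    rw [if_neg]
    exact fun h => hb (h.unique hA)
  · intro h
    exact absurd (Finset.mem_filter.2 ⟨Finset.mem_univ _, LL_le i hA.1⟩) h

theorem S_all (hW : DownwardClosed W) (hwb : Wb M W) {E : C} (k : ℕ)
    (hk : ∀ H : C, H ∈ W → ∀ φ : Epis H E, 0 ≤ vv M W k H φ) (j : ℕ) :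
    ∀ i, i + j = k → ∑' p : Sg W E, ENNReal.ofReal (vv M W i p.1.1.out p.2) =
      ∑' p : Sg W E, ENNReal.ofReal (vv M W k p.1.1.out p.2) := by
  induction j with
  | zero => rintro i rfl; rfl
  | succ j ih =>
    intro i hi
    rw [S_step M hW hwb i (vv_nonneg M hW hwb k hk j (i+1) (by omega))]
    exact ih (i+1) (by omega)

theorem base_sum (hW : DownwardClosed W) {E : C} (hE : E ∈ W) :
    ∑' g : Sg W E, (if ⊤ = qo g.2 then M g.1.1 / (nA g.1.1.out : ℝ) else 0) = M (cls E) := by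
  let X : WSub W := ⟨cls E, cls_mem hW hE⟩
  let j : (X.1.out ≅ E) → Sg W E := fun f => ⟨X, isoE f⟩
  have hj : Function.Injective j := by
    intro f g h
    simp only [j, Sigma.mk.injEq, heq_eq_eq, true_and] at h
    exact isoE_inj h
  have hqi : ∀ {H : C} (f : H ≅ E), qo (isoE f) = ⊤ := by
    intro H f
    rw [← id_comp (isoE f), qo_isoE, qo_id]
  rw [← hj.tsum_eq]
  · have e : (X.1.out ≅ E) ≃ (X.1.out ≅ X.1.out) :=
      ⟨fun f => f ≪≫ outIso E, fun f => f ≪≫ (outIso E).symm, fun f => by ext; simp,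
        fun f => by ext; simp⟩
    have hcard : Nat.card (X.1.out ≅ E) = nA X.1.out := Nat.card_congr e
    simp only [j, hqi, if_true]
    rw [tsum_const, hcard, nsmul_eq_mul]
    have := nA_pos X.1.out
    field_simp
    rfl
  · rintro ⟨G, σ⟩ hg
    simp only [Function.mem_support, ne_eq, ite_eq_right_iff, Classical.not_imp] at hg
    have h1 : qo (idE _) = qo σ := by rw [qo_id, ← hg.1]
    obtain ⟨f, hf⟩ := qo_eq_iso _ _ h1
    rw [id_comp] at hf
    have hG : G = X := by
      apply Subtype.ext
      have := cls_eq f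
      rwa [cls_out] at this
    subst hG
    exact ⟨f, by simp only [j, hf]⟩

theorem base (hW : DownwardClosed W) (hwb : Wb M W) {E : C} (hE : E ∈ W) :
    HasSum (fun p : Sg W E => vv M W 0 p.1.1.out p.2) (M (cls E)) := by
  let c : ∀ g : Sg W E, Quotients g.1.1.out → ℝ := fun g a =>
    (if LL 0 (qo g.2) ⊤ then mu a ⊤ else 0) * (M g.1.1 / (nA g.1.1.out : ℝ))
  have hc : ∀ g : Sg W E, ∀ φ : ℝ → ℝ, φ 0 = 0 → ∑ a with qo g.2 ≤ a, φ (c g a) =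
      if ⊤ = qo g.2 then φ (M g.1.1 / (nA g.1.1.out : ℝ)) else 0 := by
    intro g φ h0
    by_cases h : ⊤ = qo g.2
    · have hh : ∀ a : Quotients g.1.1.out, ⊤ ≤ a ↔ a = ⊤ := fun a => top_le_iff
      simp only [c, LL, ← h, hh, if_true]
      rw [Finset.sum_filter, Finset.sum_ite_eq' Finset.univ ⊤]
      simp [mu_self]
    · simp [c, LL, h, h0]
  have hs : Summable fun g : Sg W E => ∑ a with qo g.2 ≤ a, |c g a| := by
    refine Summable.of_nonneg_of_le (fun g => Finset.sum_nonneg fun _ _ => abs_nonneg _)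
      (fun g => ?_) (hwb E hE)
    rw [hc g (fun x => |x|) abs_zero]
    split_ifs with h
    · rw [← h, mu_self, abs_one, mul_one, abs_div, Nat.abs_cast]
      have h1 : (1:ℝ) ≤ Zi (⊤ : Quotients g.1.1.out) := by exact_mod_cast Zi_ge_one _
      have h2 : (1:ℝ) ≤ (Zi (⊤ : Quotients g.1.1.out) : ℝ) ^ 3 := one_le_pow₀ h1
      exact le_mul_of_one_le_left (by positivity) h2
    · positivity
  have h1 := fub hW E c hs
  have hc1 : ∀ g : Sg W E, ∑ a with qo g.2 ≤ a, c g a =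
      if ⊤ = qo g.2 then (M g.1.1 / (nA g.1.1.out : ℝ)) else 0 := fun g => hc g id rfl
  rw [tsum_congr hc1] at h1
  have h0 := base_sum M hW hE
  rw [h0] at h1
  have h2 := h1.sigma (fun h => (h1.summable.sigma_factor h).hasSum)
  refine HasSum.congr_fun h2 fun p => ?_
  refine tsum_congr fun b => ?_
  simp only [vt, c]
  ring

theorem vv_top (hwb : Wb M W) {mob : ∀ G : C, Quotients G → Quotients G → ℝ}
    (hmob : IsMobiusFamily mob) (k : ℕ) (hk : ∀ G ∈ W, complexityLE G k) {E H : C} (hH : H ∈ W)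
    (φ : Epis H E) : vv M W k H φ = vWF mob M W H := by
  have hs : Summable (vt M W k H φ) := by
    refine Summable.of_norm_bounded ((hwb H hH).mul_right (1 / (nA H : ℝ))) fun p => ?_
    rw [vt, if_pos (LL_cx (hk _ p.1.2) _), Real.norm_eq_abs, abs_div, abs_div, abs_mul,
      Nat.abs_cast, Nat.abs_cast]
    have h1 : (1:ℝ) ≤ Zi (qo p.2) := by exact_mod_cast Zi_ge_one _
    have h2 : (1:ℝ) ≤ (Zi (qo p.2) : ℝ) ^ 3 := one_le_pow₀ h1
    calc _ = 1 * (|mu (qo p.2) ⊤| * (|M p.1.1| / (nA p.1.1.out : ℝ)) * (1 / (nA H : ℝ))) := by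
          ring
      _ ≤ (Zi (qo p.2) : ℝ) ^ 3 *
          (|mu (qo p.2) ⊤| * (|M p.1.1| / (nA p.1.1.out : ℝ)) * (1 / (nA H : ℝ))) := by
          gcongr
      _ = _ := by ring
  rw [vv, hs.tsum_sigma' (fun g => Summable.of_finite), vWF]
  refine tsum_congr fun X => ?_
  have h1 : ∀ π : Epis X.1.out H, vt M W k H φ ⟨X, π⟩ =
      muEpi mob π.1 π.2 * (M X.1 / (nA X.1.out : ℝ) / (nA H : ℝ)) := by
    intro π
    rw [vt, if_pos (LL_cx (hk _ X.2) _), muEpi, mob_eq mob hmob _ _ _ le_top]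
    simp only [qo]
    ring
  rw [tsum_congr h1, tsum_mul_right, muHat]
  simp only [nA]
  ring

theorem final (hW : DownwardClosed W) {mob : ∀ G : C, Quotients G → Quotients G → ℝ}
    (hmob : IsMobiusFamily mob) (k : ℕ) (hk : ∀ G ∈ W, complexityLE G k) {E : C} (hE : E ∈ W)
    (hwb' : WellBehavedAt mob M W) (hv : ∀ H : C, H ∈ W → 0 ≤ vWF mob M W H) :
    (∑' H : WSub W, (Nat.card (Epis H.1.out E) : ℝ) * vWF mob M W H.1.out) = M (cls E) := by
  have hwb := wb_of M hmob hwb'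
  have hvk : ∀ H : C, H ∈ W → ∀ φ : Epis H E, vv M W k H φ = vWF mob M W H :=
    fun H hH φ => vv_top M hwb hmob k hk hH φ
  have hnn : ∀ H : C, H ∈ W → ∀ φ : Epis H E, 0 ≤ vv M W k H φ := by
    intro H hH φ
    rw [hvk H hH φ]
    exact hv H hH
  have h00 := vv_nonneg M hW hwb k hnn k 0 (by omega)
  have h0 : ∀ p : Sg W E, 0 ≤ vv M W 0 p.1.1.out p.2 := fun p => h00 p.1.1.out p.1.2 p.2
  have hS := S_all M hW hwb k hnn k 0 (by omega)
  have hb := base M hW hwb hE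
  rw [← ENNReal.ofReal_tsum_of_nonneg h0 hb.summable, hb.tsum_eq] at hS
  have hM : 0 ≤ M (cls E) := hb.nonneg h0
  let g : Sg W E → ℝ := fun p => vWF mob M W p.1.1.out
  have hg : ∀ p, 0 ≤ g p := fun p => hv _ p.1.2
  have hS' : ∑' p, ENNReal.ofReal (g p) = ENNReal.ofReal (M (cls E)) := by
    rw [hS]
    exact tsum_congr fun p => by rw [hvk _ p.1.2 p.2]
  have hsum : Summable g := by
    have h1 := ENNReal.summable_toReal (f := fun p => ENNReal.ofReal (g p))
      (by rw [hS']; exact ENNReal.ofReal_ne_top)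
    exact h1.congr fun p => ENNReal.toReal_ofReal (hg p)
  have htot : ∑' p, g p = M (cls E) := by
    rw [← ENNReal.ofReal_tsum_of_nonneg hg hsum] at hS'
    exact (ENNReal.ofReal_eq_ofReal_iff (tsum_nonneg hg) hM).1 hS'
  rw [← htot, hsum.tsum_sigma' (fun g => Summable.of_finite)]
  refine tsum_congr fun H => ?_
  simp only [g]
  rw [tsum_const, nsmul_eq_mul]

end an
end MomentAux

open MomentCat in
/-- Proposition 4.8: for a narrow formation `W` of finite
complexity, `E ∈ W`, `(M_G)` well-behaved at `W` and `v_{W,H} ≥ 0` for all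
`H ∈ W`, one has `∑_{H ∈ W} |Epi(H,E)| v_{W,H} = M_E`. -/
theorem statement8 {C : Type u} [SmallCategory C] (hC : IsDiamond C)
    (mob : ∀ G : C, Quotients G → Quotients G → ℝ) (hmob : IsMobiusFamily mob)
    (W : Set C) (hW : IsFormation W) (hWn : Narrow W)
    (hfc : ∃ k : ℕ, ∀ G ∈ W, complexityLE G k)
    (E : C) (hE : E ∈ W)
    (M : IsoCls C → ℝ) (hwb : WellBehavedAt mob M W)
    (hv : ∀ H : C, H ∈ W → 0 ≤ vWF mob M W H) :
    (∑' H : WSub W, (Nat.card (Epis H.1.out E) : ℝ) * vWF mob M W H.1.out)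
      = M (cls E) := by
  have : Fact (IsDiamond C) := ⟨hC⟩
  obtain ⟨k, hk⟩ := hfc
  exact MomentAux.final M hW.1 hmob k hk hE hwb hv
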